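/- arXiv:1911.05112 — 14 statements merged into one kernel-verified Lean document; each statement's English description precedes it below -/
import Mathlib

section
/- Let M, N₀ be positive integers, γ > 0 a real number, E ∈ ℝ, H ∈ Matrix (Fin M) (Fin M) ℂ Hermitian, and W ∈ Matrix (Fin M) (Fin N₀) ℂ. If the matrix A := E•1 − H + (i·γ)•(W ⬝ Wᴴ) is invertible, then the scattering matrix S := 1 − (2·i·γ)•(Wᴴ ⬝ A⁻¹ ⬝ W) ∈ Matrix (Fin N₀) (Fin N₀) ℂ is unitary, i.e. S ⬝ Sᴴ = 1 and Sᴴ ⬝ S = 1. -/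
open Matrix Complex

/-- **Unitarity of the scattering matrix.**
If `A = E•1 − H + (i·γ)•(W ⬝ Wᴴ)` is invertible (with `H` Hermitian), then the
scattering matrix `S = 1 − (2·i·γ)•(Wᴴ ⬝ A⁻¹ ⬝ W)` is unitary. -/
theorem scattering_matrix_unitary
    (M N₀ : ℕ) (hM : 0 < M) (hN₀ : 0 < N₀)
    (γ : ℝ) (hγ : 0 < γ) (E : ℝ)
    (H : Matrix (Fin M) (Fin M) ℂ) (hH : H.IsHermitian)
    (W : Matrix (Fin M) (Fin N₀) ℂ)
    (A : Matrix (Fin M) (Fin M) ℂ)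
    (hA : A = (E : ℂ) • (1 : Matrix (Fin M) (Fin M) ℂ) - H
        + (Complex.I * (γ : ℂ)) • (W * Wᴴ))
    (hAinv : IsUnit A.det)
    (S : Matrix (Fin N₀) (Fin N₀) ℂ)
    (hS : S = (1 : Matrix (Fin N₀) (Fin N₀) ℂ)
        - ((2 : ℂ) * Complex.I * (γ : ℂ)) • (Wᴴ * A⁻¹ * W)) :
    S * Sᴴ = 1 ∧ Sᴴ * S = 1 := by
  have hW : A - Aᴴ = ((2 : ℂ) * Complex.I * (γ : ℂ)) • (W * Wᴴ) := by
    rw [hA]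
    simp only [conjTranspose_add, conjTranspose_sub, conjTranspose_smul, conjTranspose_mul,
      conjTranspose_conjTranspose, conjTranspose_one, hH.eq, star_mul', Complex.star_def,
      Complex.conj_I, Complex.conj_ofReal]
    module
  have hdH : IsUnit Aᴴ.det := by
    rw [det_conjTranspose]
    exact hAinv.star
  have hkey : ((2 : ℂ) * Complex.I * (γ : ℂ)) • (A⁻¹ * (W * Wᴴ) * (Aᴴ)⁻¹)
      = (Aᴴ)⁻¹ - A⁻¹ := by
    rw [← Matrix.smul_mul, ← Matrix.mul_smul, ← hW, Matrix.mul_sub, Matrix.sub_mul,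
      nonsing_inv_mul _ hAinv, Matrix.one_mul, Matrix.mul_assoc, mul_nonsing_inv _ hdH,
      Matrix.mul_one]
  have hSH : Sᴴ = 1 + ((2 : ℂ) * Complex.I * (γ : ℂ)) • (Wᴴ * (Aᴴ)⁻¹ * W) := by
    rw [hS]
    simp only [conjTranspose_sub, conjTranspose_smul, conjTranspose_mul,
      conjTranspose_conjTranspose, conjTranspose_one, star_mul', Complex.star_def,
      Complex.conj_I, Complex.conj_ofReal, conjTranspose_nonsing_inv, Matrix.mul_assoc,
      map_ofNat]
    module
  have h1 : S * Sᴴ = 1 := by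
    have h2 : ((2 : ℂ) * Complex.I * (γ : ℂ)) • ((Wᴴ * A⁻¹ * W) * (Wᴴ * (Aᴴ)⁻¹ * W))
        = Wᴴ * (Aᴴ)⁻¹ * W - Wᴴ * A⁻¹ * W := by
      rw [← Matrix.sub_mul, ← Matrix.mul_sub, ← hkey]
      simp only [Matrix.mul_smul, Matrix.smul_mul, Matrix.mul_assoc]
    rw [hSH, hS, Matrix.sub_mul, Matrix.one_mul, Matrix.mul_add, Matrix.mul_one,
      Matrix.mul_smul, Matrix.smul_mul, h2]
    module
  exact ⟨h1, mul_eq_one_comm.mp h1⟩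
end

section
/- Let N ≥ 1, γ > 0, 𝒴 ∈ ℂ, H ∈ Matrix (Fin N) (Fin N) ℂ Hermitian, and W₁, W₂ ∈ Matrix (Fin N) (Fin N) ℂ. Assume that B := 𝒴•1 − H + (i·γ)•(W₁ ⬝ W₁ᴴ + W₂ ⬝ W₂ᴴ) is invertible (for example this holds whenever Im 𝒴 > 0), and let z ∈ ℂ with Im z > 0. Then the 8N×8N matrix 𝐇_𝒴 − z•(J₈ ⊗ 1_N) is invertible, the matrix T_𝒴 − z•1_N is invertible, and the upper-left N×N block of (𝐇_𝒴 − z•(J₈ ⊗ 1_N))⁻¹ equals (T_𝒴 − z•1_N)⁻¹; entrywise, [(𝐇_𝒴 − z J₈⊗1)⁻¹]_{ij} = [(T_𝒴 − z·1)⁻¹]_{ij} for all 1 ≤ i, j ≤ N. -/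
open Matrix

noncomputable section

/-- The self-adjoint linearization `𝐇_𝒴 ∈ M_{8N}(ℂ)`, an `8 × 8` array of `N × N` blocks. -/
def linMat (N : ℕ) (γ : ℝ) (𝒴 : ℂ) (H W₁ W₂ : Matrix (Fin N) (Fin N) ℂ) :
    Matrix (Fin 8 × Fin N) (Fin 8 × Fin N) ℂ :=
  fun p q =>
    (!![0, 0, 0, 0, 0, 0, 0, W₂ᴴ;
        0, 0, (Complex.I / (γ : ℂ)) • (1 : Matrix (Fin N) (Fin N) ℂ), 0, 0, 0, 0, W₂ᴴ;
        0, -((Complex.I / (γ : ℂ)) • (1 : Matrix (Fin N) (Fin N) ℂ)), 0, 0, 0, 0, W₂ᴴ, 0;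
        0, 0, 0, 0, 0, (Complex.I / (γ : ℂ)) • (1 : Matrix (Fin N) (Fin N) ℂ), 0, W₁ᴴ;
        0, 0, 0, 0, -((1 / (4 * (γ : ℂ) ^ 2)) • (1 : Matrix (Fin N) (Fin N) ℂ)), 0, W₁ᴴ, 0;
        0, 0, 0, -((Complex.I / (γ : ℂ)) • (1 : Matrix (Fin N) (Fin N) ℂ)), 0, 0, W₁ᴴ, 0;
        0, 0, W₂, 0, W₁, W₁, 0, 𝒴 • (1 : Matrix (Fin N) (Fin N) ℂ) - H;
        W₂, W₂, 0, W₁, 0, 0, (starRingEnd ℂ 𝒴) • (1 : Matrix (Fin N) (Fin N) ℂ) - H, 0] :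
      Matrix (Fin 8) (Fin 8) (Matrix (Fin N) (Fin N) ℂ)) p.1 q.1 p.2 q.2

/-- `J₈ ⊗ 1_N` : the `8N × 8N` matrix whose `(1,1)` block is `1_N` and all other blocks are `0`. -/
def Jmat (N : ℕ) : Matrix (Fin 8 × Fin N) (Fin 8 × Fin N) ℂ :=
  fun p q => if p.1 = 0 ∧ q.1 = 0 then (1 : Matrix (Fin N) (Fin N) ℂ) p.2 q.2 else 0

lemma aux_mul {N : ℕ} (γ : ℝ) (𝒴 : ℂ) (H W₁ W₂ : Matrix (Fin N) (Fin N) ℂ) (z : ℂ)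
    (v : Fin 8 × Fin N → ℂ) (f : Fin N → ℂ)
    (h : (linMat N γ 𝒴 H W₁ W₂ - z • Jmat N) *ᵥ v = fun p => if p.1 = 0 then f p.2 else 0) :
    let u : Fin 8 → Fin N → ℂ := fun k i => v (k, i)
    W₂ᴴ *ᵥ u 7 - z • u 0 = f ∧
    (Complex.I / (γ : ℂ)) • u 2 + W₂ᴴ *ᵥ u 7 = 0 ∧
    -((Complex.I / (γ : ℂ)) • u 1) + W₂ᴴ *ᵥ u 6 = 0 ∧
    (Complex.I / (γ : ℂ)) • u 5 + W₁ᴴ *ᵥ u 7 = 0 ∧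
    -((1 / (4 * (γ : ℂ) ^ 2)) • u 4) + W₁ᴴ *ᵥ u 6 = 0 ∧
    -((Complex.I / (γ : ℂ)) • u 3) + W₁ᴴ *ᵥ u 6 = 0 ∧
    W₂ *ᵥ u 2 + W₁ *ᵥ u 4 + W₁ *ᵥ u 5 + (𝒴 • u 7 - H *ᵥ u 7) = 0 ∧
    W₂ *ᵥ u 0 + W₂ *ᵥ u 1 + W₁ *ᵥ u 3 + ((starRingEnd ℂ 𝒴) • u 6 - H *ᵥ u 6) = 0 := by
  intro u
  have hu : ∀ k i, u k i = v (k, i) := fun _ _ => rfl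
  have key : ∀ (k : Fin 8), (∑ l : Fin 8, (Matrix.of fun i j =>
      linMat N γ 𝒴 H W₁ W₂ (k, i) (l, j)) *ᵥ u l) - (if k = 0 then z • u 0 else 0)
      = if k = 0 then f else 0 := by
    intro k
    ext i
    have hJ : (Jmat N *ᵥ v) (k, i) = if k = 0 then u 0 i else 0 := by
      simp only [Matrix.mulVec, dotProduct, Fintype.sum_prod_type, Jmat]
      rw [Finset.sum_eq_single 0]
      · by_cases hk : k = 0
        · simp [hk, Matrix.one_apply, hu]
        · simp [hk]
      · intro b _ hb
        simp [hb]
      · simp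
    have := congrFun h (k, i)
    rw [Matrix.sub_mulVec, Matrix.smul_mulVec, Pi.sub_apply, Pi.smul_apply, hJ] at this
    simp only [Matrix.mulVec, dotProduct, Fintype.sum_prod_type] at this
    simp only [Pi.sub_apply, Finset.sum_apply, Matrix.mulVec, dotProduct, Matrix.of_apply]
    by_cases hk : k = 0
    · simp only [hk, if_true] at this ⊢
      exact this
    · simp only [hk, if_false, smul_zero] at this ⊢
      exact this
  simp only [Fin.sum_univ_eight] at key
  have k0 : (0 : Matrix (Fin N) (Fin N) ℂ) *ᵥ u 0
      + (0 : Matrix (Fin N) (Fin N) ℂ) *ᵥ u 1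
      + (0 : Matrix (Fin N) (Fin N) ℂ) *ᵥ u 2
      + (0 : Matrix (Fin N) (Fin N) ℂ) *ᵥ u 3
      + (0 : Matrix (Fin N) (Fin N) ℂ) *ᵥ u 4
      + (0 : Matrix (Fin N) (Fin N) ℂ) *ᵥ u 5
      + (0 : Matrix (Fin N) (Fin N) ℂ) *ᵥ u 6
      + (W₂ᴴ) *ᵥ u 7
      - z • u 0 = f := key 0
  have k1 : (0 : Matrix (Fin N) (Fin N) ℂ) *ᵥ u 0
      + (0 : Matrix (Fin N) (Fin N) ℂ) *ᵥ u 1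
      + (((Complex.I / (γ : ℂ)) • (1 : Matrix (Fin N) (Fin N) ℂ))) *ᵥ u 2
      + (0 : Matrix (Fin N) (Fin N) ℂ) *ᵥ u 3
      + (0 : Matrix (Fin N) (Fin N) ℂ) *ᵥ u 4
      + (0 : Matrix (Fin N) (Fin N) ℂ) *ᵥ u 5
      + (0 : Matrix (Fin N) (Fin N) ℂ) *ᵥ u 6
      + (W₂ᴴ) *ᵥ u 7
      - 0 = 0 := key 1
  have k2 : (0 : Matrix (Fin N) (Fin N) ℂ) *ᵥ u 0
      + (-((Complex.I / (γ : ℂ)) • (1 : Matrix (Fin N) (Fin N) ℂ))) *ᵥ u 1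
      + (0 : Matrix (Fin N) (Fin N) ℂ) *ᵥ u 2
      + (0 : Matrix (Fin N) (Fin N) ℂ) *ᵥ u 3
      + (0 : Matrix (Fin N) (Fin N) ℂ) *ᵥ u 4
      + (0 : Matrix (Fin N) (Fin N) ℂ) *ᵥ u 5
      + (W₂ᴴ) *ᵥ u 6
      + (0 : Matrix (Fin N) (Fin N) ℂ) *ᵥ u 7
      - 0 = 0 := key 2
  have k3 : (0 : Matrix (Fin N) (Fin N) ℂ) *ᵥ u 0
      + (0 : Matrix (Fin N) (Fin N) ℂ) *ᵥ u 1
      + (0 : Matrix (Fin N) (Fin N) ℂ) *ᵥ u 2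
      + (0 : Matrix (Fin N) (Fin N) ℂ) *ᵥ u 3
      + (0 : Matrix (Fin N) (Fin N) ℂ) *ᵥ u 4
      + (((Complex.I / (γ : ℂ)) • (1 : Matrix (Fin N) (Fin N) ℂ))) *ᵥ u 5
      + (0 : Matrix (Fin N) (Fin N) ℂ) *ᵥ u 6
      + (W₁ᴴ) *ᵥ u 7
      - 0 = 0 := key 3
  have k4 : (0 : Matrix (Fin N) (Fin N) ℂ) *ᵥ u 0
      + (0 : Matrix (Fin N) (Fin N) ℂ) *ᵥ u 1
      + (0 : Matrix (Fin N) (Fin N) ℂ) *ᵥ u 2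
      + (0 : Matrix (Fin N) (Fin N) ℂ) *ᵥ u 3
      + (-((1 / (4 * (γ : ℂ) ^ 2)) • (1 : Matrix (Fin N) (Fin N) ℂ))) *ᵥ u 4
      + (0 : Matrix (Fin N) (Fin N) ℂ) *ᵥ u 5
      + (W₁ᴴ) *ᵥ u 6
      + (0 : Matrix (Fin N) (Fin N) ℂ) *ᵥ u 7
      - 0 = 0 := key 4
  have k5 : (0 : Matrix (Fin N) (Fin N) ℂ) *ᵥ u 0
      + (0 : Matrix (Fin N) (Fin N) ℂ) *ᵥ u 1
      + (0 : Matrix (Fin N) (Fin N) ℂ) *ᵥ u 2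
      + (-((Complex.I / (γ : ℂ)) • (1 : Matrix (Fin N) (Fin N) ℂ))) *ᵥ u 3
      + (0 : Matrix (Fin N) (Fin N) ℂ) *ᵥ u 4
      + (0 : Matrix (Fin N) (Fin N) ℂ) *ᵥ u 5
      + (W₁ᴴ) *ᵥ u 6
      + (0 : Matrix (Fin N) (Fin N) ℂ) *ᵥ u 7
      - 0 = 0 := key 5
  have k6 : (0 : Matrix (Fin N) (Fin N) ℂ) *ᵥ u 0
      + (0 : Matrix (Fin N) (Fin N) ℂ) *ᵥ u 1
      + (W₂) *ᵥ u 2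
      + (0 : Matrix (Fin N) (Fin N) ℂ) *ᵥ u 3
      + (W₁) *ᵥ u 4
      + (W₁) *ᵥ u 5
      + (0 : Matrix (Fin N) (Fin N) ℂ) *ᵥ u 6
      + (𝒴 • (1 : Matrix (Fin N) (Fin N) ℂ) - H) *ᵥ u 7
      - 0 = 0 := key 6
  have k7 : (W₂) *ᵥ u 0
      + (W₂) *ᵥ u 1
      + (0 : Matrix (Fin N) (Fin N) ℂ) *ᵥ u 2
      + (W₁) *ᵥ u 3
      + (0 : Matrix (Fin N) (Fin N) ℂ) *ᵥ u 4
      + (0 : Matrix (Fin N) (Fin N) ℂ) *ᵥ u 5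
      + ((starRingEnd ℂ 𝒴) • (1 : Matrix (Fin N) (Fin N) ℂ) - H) *ᵥ u 6
      + (0 : Matrix (Fin N) (Fin N) ℂ) *ᵥ u 7
      - 0 = 0 := key 7
  clear key h
  simp only [Matrix.zero_mulVec, zero_add, add_zero, sub_zero, Matrix.sub_mulVec,
    Matrix.neg_mulVec, Matrix.smul_mulVec, Matrix.one_mulVec] at k0 k1 k2 k3 k4 k5 k6 k7
  exact ⟨k0, k1, k2, k3, k4, k5, k6, k7⟩

lemma aux_solve {N : ℕ} (γ : ℝ) (hγ : 0 < γ) (𝒴 : ℂ)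
    (H W₁ W₂ : Matrix (Fin N) (Fin N) ℂ) (hH : H.IsHermitian)
    (B : Matrix (Fin N) (Fin N) ℂ)
    (hB : B = 𝒴 • (1 : Matrix (Fin N) (Fin N) ℂ) - H
        + (Complex.I * (γ : ℂ)) • (W₁ * W₁ᴴ + W₂ * W₂ᴴ))
    (hBinv : IsUnit B.det)
    (T : Matrix (Fin N) (Fin N) ℂ)
    (hT : T = (4 * (γ : ℂ) ^ 2) • (W₂ᴴ * B⁻¹ * W₁ * W₁ᴴ * (Bᴴ)⁻¹ * W₂))
    (z : ℂ) (v : Fin 8 × Fin N → ℂ) (f : Fin N → ℂ)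
    (h : (linMat N γ 𝒴 H W₁ W₂ - z • Jmat N) *ᵥ v = fun p => if p.1 = 0 then f p.2 else 0) :
    (T - z • (1 : Matrix (Fin N) (Fin N) ℂ)) *ᵥ (fun i => v (0, i)) = f ∧
    ((fun i => v (0, i)) = 0 → v = 0) := by
  have hγ' : (γ : ℂ) ≠ 0 := by exact_mod_cast hγ.ne'
  have hI := Complex.I_mul_I
  have hBH : Bᴴ = (starRingEnd ℂ 𝒴) • (1 : Matrix (Fin N) (Fin N) ℂ) - H
        - (Complex.I * (γ : ℂ)) • (W₁ * W₁ᴴ + W₂ * W₂ᴴ) := by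
    rw [hB]
    simp [Matrix.conjTranspose_smul, hH.eq, Matrix.conjTranspose_mul, sub_eq_add_neg]
    abel
  have hBHinv : IsUnit Bᴴ.det := by
    rw [Matrix.det_conjTranspose]; exact hBinv.star
  obtain ⟨h0, h1, h2, h3, h4, h5, h6, h7⟩ := aux_mul γ 𝒴 H W₁ W₂ z v f h
  set u : Fin 8 → Fin N → ℂ := fun k i => v (k, i) with hu
  have c1 : ∀ a b : Fin N → ℂ, (Complex.I / (γ : ℂ)) • a + b = 0 →
      a = (Complex.I * (γ : ℂ)) • b := by
    intro a b hab
    rw [eq_neg_of_add_eq_zero_right hab, smul_neg, smul_smul]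
    rw [show Complex.I * (γ : ℂ) * (Complex.I / (γ : ℂ)) = -1 by field_simp; simp]
    simp
  have c2 : ∀ a b : Fin N → ℂ, -((Complex.I / (γ : ℂ)) • a) + b = 0 →
      a = -((Complex.I * (γ : ℂ)) • b) := by
    intro a b hab
    rw [← smul_neg]
    exact c1 a (-b) (by rw [← neg_eq_zero, ← hab]; abel)
  have e2 := c1 _ _ h1
  have e1 := c2 _ _ h2
  have e5 := c1 _ _ h3
  have e3 := c2 _ _ h5
  have e4 : u 4 = (4 * (γ : ℂ) ^ 2) • (W₁ᴴ *ᵥ u 6) := by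
    rw [neg_add_eq_zero.mp h4 |>.symm, smul_smul]
    rw [show 4 * (γ : ℂ) ^ 2 * (1 / (4 * (γ : ℂ) ^ 2)) = 1 by field_simp]
    simp
  have e7 : B *ᵥ u 7 = -((4 * (γ : ℂ) ^ 2) • (W₁ *ᵥ (W₁ᴴ *ᵥ u 6))) := by
    rw [eq_neg_iff_add_eq_zero, ← h6, e2, e4, e5, hB]
    simp only [Matrix.add_mulVec, Matrix.sub_mulVec, Matrix.smul_mulVec, Matrix.mulVec_smul,
      Matrix.one_mulVec, ← Matrix.mulVec_mulVec, smul_add]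
    abel
  have e6 : Bᴴ *ᵥ u 6 = -(W₂ *ᵥ u 0) := by
    rw [eq_neg_iff_add_eq_zero, ← h7, e1, e3, hBH]
    simp only [Matrix.add_mulVec, Matrix.sub_mulVec, Matrix.smul_mulVec, Matrix.mulVec_smul,
      Matrix.mulVec_neg,
      Matrix.one_mulVec, ← Matrix.mulVec_mulVec, smul_add]
    abel
  have inv : ∀ (A : Matrix (Fin N) (Fin N) ℂ), IsUnit A.det → ∀ a b, A *ᵥ a = b →
      a = A⁻¹ *ᵥ b := by
    intro A hA a b hab
    rw [← hab, Matrix.mulVec_mulVec, Matrix.nonsing_inv_mul _ hA, Matrix.one_mulVec]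
  have g6 := inv _ hBHinv _ _ e6
  have g7 := inv _ hBinv _ _ e7
  constructor
  · change _ *ᵥ u 0 = f
    rw [← h0, g7, g6, hT]
    simp only [Matrix.sub_mulVec, Matrix.smul_mulVec, Matrix.mulVec_smul, Matrix.mulVec_neg,
      Matrix.one_mulVec, ← Matrix.mulVec_mulVec, smul_neg, neg_neg]
  · intro hz0
    change u 0 = 0 at hz0
    rw [hz0] at g6
    simp only [Matrix.mulVec_zero, neg_zero] at g6
    rw [g6] at g7 e1 e3 e4
    simp only [Matrix.mulVec_zero, neg_zero, smul_zero] at g7 e1 e3 e4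
    rw [g7] at e2 e5
    simp only [Matrix.mulVec_zero, smul_zero] at e2 e5
    ext ⟨k, i⟩
    change u k i = 0
    have : u k = 0 := by
      fin_cases k
      exacts [hz0, e1, e2, e3, e4, e5, g6, g7]
    rw [this]; rfl

open scoped ComplexOrder in
lemma aux_unit {N : ℕ} (T : Matrix (Fin N) (Fin N) ℂ) (hT : T.IsHermitian)
    (z : ℂ) (hz : 0 < z.im) :
    IsUnit (T - z • (1 : Matrix (Fin N) (Fin N) ℂ)).det := by
  rw [← Matrix.isUnit_iff_isUnit_det, ← Matrix.mulVec_injective_iff_isUnit]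
  refine (injective_iff_map_eq_zero (Matrix.mulVecLin (T - z • 1))).mpr ?_
  intro v hv
  rw [Matrix.mulVecLin_apply, Matrix.sub_mulVec, Matrix.smul_mulVec, Matrix.one_mulVec,
    sub_eq_zero] at hv
  have h1 : star v ⬝ᵥ (T *ᵥ v) = z * (star v ⬝ᵥ v) := by
    rw [hv, dotProduct_smul, smul_eq_mul]
  have h2 : star v ⬝ᵥ (T *ᵥ v) = star z * (star v ⬝ᵥ v) := by
    have h4 : star v ᵥ* T = star z • star v := by
      rw [← star_smul, ← hv, Matrix.star_mulVec, hT.eq]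
    rw [Matrix.dotProduct_mulVec, h4, smul_dotProduct, smul_eq_mul]
  have h3 : (z - star z) * (star v ⬝ᵥ v) = 0 := by
    rw [sub_mul, ← h1, ← h2, sub_self]
  rcases mul_eq_zero.mp h3 with h | h
  · have := congrArg Complex.im h
    simp at this
    linarith
  · exact dotProduct_star_self_eq_zero.mp h

/-- **Generalized resolvent identity (Lemma 2.1(ii)).**
If `B = 𝒴•1 − H + iγ(W₁W₁ᴴ + W₂W₂ᴴ)` is invertible and `Im z > 0`, then the generalized
resolvent of the linearization exists, `T_𝒴 − z•1` is invertible, and the upper-left `N × N`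
block of `(𝐇_𝒴 − z•(J₈ ⊗ 1_N))⁻¹` equals `(T_𝒴 − z•1)⁻¹`. -/
theorem generalized_resolvent_upper_left_block
    (N : ℕ) (hN : 1 ≤ N) (γ : ℝ) (hγ : 0 < γ) (𝒴 : ℂ)
    (H W₁ W₂ : Matrix (Fin N) (Fin N) ℂ) (hH : H.IsHermitian)
    (B : Matrix (Fin N) (Fin N) ℂ)
    (hB : B = 𝒴 • (1 : Matrix (Fin N) (Fin N) ℂ) - H
        + (Complex.I * (γ : ℂ)) • (W₁ * W₁ᴴ + W₂ * W₂ᴴ))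
    (hBinv : IsUnit B.det)
    (T : Matrix (Fin N) (Fin N) ℂ)
    (hT : T = (4 * (γ : ℂ) ^ 2) • (W₂ᴴ * B⁻¹ * W₁ * W₁ᴴ * (Bᴴ)⁻¹ * W₂))
    (z : ℂ) (hz : 0 < z.im) :
    IsUnit (linMat N γ 𝒴 H W₁ W₂ - z • Jmat N).det ∧
    IsUnit (T - z • (1 : Matrix (Fin N) (Fin N) ℂ)).det ∧
    ∀ i j : Fin N,
      (linMat N γ 𝒴 H W₁ W₂ - z • Jmat N)⁻¹ (0, i) (0, j)
        = (T - z • (1 : Matrix (Fin N) (Fin N) ℂ))⁻¹ i j := by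
  have hTh : T.IsHermitian := by
    rw [hT]
    unfold Matrix.IsHermitian
    simp [Matrix.conjTranspose_smul, Matrix.conjTranspose_mul, Matrix.conjTranspose_nonsing_inv,
      Matrix.mul_assoc]
  have hTu := aux_unit T hTh z hz
  have solve := aux_solve γ hγ 𝒴 H W₁ W₂ hH B hB hBinv T hT z
  have inv : ∀ a b, (T - z • (1 : Matrix (Fin N) (Fin N) ℂ)) *ᵥ a = b →
      a = (T - z • (1 : Matrix (Fin N) (Fin N) ℂ))⁻¹ *ᵥ b := by
    intro a b hab
    rw [← hab, Matrix.mulVec_mulVec, Matrix.nonsing_inv_mul _ hTu, Matrix.one_mulVec]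
  have hM : IsUnit (linMat N γ 𝒴 H W₁ W₂ - z • Jmat N).det := by
    rw [← Matrix.isUnit_iff_isUnit_det, ← Matrix.mulVec_injective_iff_isUnit]
    refine (injective_iff_map_eq_zero
      (Matrix.mulVecLin (linMat N γ 𝒴 H W₁ W₂ - z • Jmat N))).mpr ?_
    intro v hv
    rw [Matrix.mulVecLin_apply] at hv
    obtain ⟨ha, hb⟩ := solve v 0 (by rw [hv]; ext p; simp)
    exact hb (by rw [inv _ _ ha, Matrix.mulVec_zero])
  refine ⟨hM, hTu, fun i j => ?_⟩
  obtain ⟨ha, -⟩ := solve ((linMat N γ 𝒴 H W₁ W₂ - z • Jmat N)⁻¹ *ᵥ Pi.single (0, j) 1)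
    (Pi.single j 1) (by
      rw [Matrix.mulVec_mulVec, Matrix.mul_nonsing_inv _ hM, Matrix.one_mulVec]
      ext ⟨k, l⟩
      by_cases hk : k = 0 <;> simp [Pi.single_apply, hk])
  have := congrFun (inv _ _ ha) i
  simpa using this

end
end

section
/- For every real γ > 0 there exists a constant C > 0, independent of the dimension, such that: for all N ≥ 1, every Hermitian H ∈ Matrix (Fin N) (Fin N) ℂ with operator norm ‖H‖ ≤ 3, all W₁, W₂ ∈ Matrix (Fin N) (Fin N) ℂ with ‖W₁‖ ≤ 3, ‖W₂‖ ≤ 3, such that W₁W₁ᴴ + W₂W₂ᴴ is invertible with ‖(W₁W₁ᴴ + W₂W₂ᴴ)⁻¹‖ ≤ 12, every 𝒴 ∈ ℂ with Im 𝒴 ≥ 0 and every z ∈ ℂ with Im z > 0, the matrix 𝐇_𝒴 − z•(J₈ ⊗ 1_N) is invertible and ‖(𝐇_𝒴 − z•(J₈ ⊗ 1_N))⁻¹‖ ≤ C·(1 + 1/Im z), where ‖·‖ denotes the operator norm on matrices. -/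
open Matrix

noncomputable section

/-- The ℓ²→ℓ² operator norm of a square complex matrix. -/
def opNorm {n : Type*} [Fintype n] [DecidableEq n] (A : Matrix n n ℂ) : ℝ :=
  ‖Matrix.toEuclideanCLM (𝕜 := ℂ) A‖

section core
variable {E : Type*} [NormedAddCommGroup E] [InnerProductSpace ℂ E] [CompleteSpace E]

open ContinuousLinearMap in
lemma coerc (γ : ℝ) (hγ : 0 < γ) (H W₁ W₂ : E →L[ℂ] E) (hH : adjoint H = H)
    (h1 : ‖W₁‖ ≤ 3) (h2 : ‖W₂‖ ≤ 3)
    (hS : ∀ x, ‖x‖ ≤ 12 * ‖W₁ (adjoint W₁ x) + W₂ (adjoint W₂ x)‖)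
    (Y : ℂ) (hY : 0 ≤ Y.im) (ε : ℝ) (hε : ε = 1 ∨ ε = -1) (x : E) :
    γ / 2592 * ‖x‖ ≤ ‖((Y.re : ℂ) + ε * Y.im * Complex.I) • x - H x
      + (ε * γ * Complex.I) • (W₁ (adjoint W₁ x) + W₂ (adjoint W₂ x))‖ := by
  set p := adjoint W₁ x with hp
  set q := adjoint W₂ x with hq
  set v := ((Y.re : ℂ) + ε * Y.im * Complex.I) • x - H x
      + (ε * γ * Complex.I) • (W₁ p + W₂ q) with hv
  have hHx : (inner ℂ x (H x)).im = 0 := by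
    have : (starRingEnd ℂ) (inner ℂ x (H x)) = inner ℂ x (H x) := by
      rw [inner_conj_symm]
      conv_rhs => rw [← hH, adjoint_inner_right]
    exact Complex.conj_eq_iff_im.mp this
  have hp2 : inner ℂ x (W₁ p) = ((‖p‖ ^ 2 : ℝ) : ℂ) := by
    rw [← adjoint_inner_left, ← hp, inner_self_eq_norm_sq_to_K]; simp
  have hq2 : inner ℂ x (W₂ q) = ((‖q‖ ^ 2 : ℝ) : ℂ) := by
    rw [← adjoint_inner_left, ← hq, inner_self_eq_norm_sq_to_K]; simp
  have hx2 : inner ℂ x x = ((‖x‖ ^ 2 : ℝ) : ℂ) := by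
    rw [inner_self_eq_norm_sq_to_K]; simp
  have him : (inner ℂ x v).im = ε * (Y.im * ‖x‖ ^ 2 + γ * (‖p‖ ^ 2 + ‖q‖ ^ 2)) := by
    rw [hv, inner_add_right, inner_sub_right, inner_smul_right, inner_smul_right,
      inner_add_right, hp2, hq2, hx2, ← Complex.ofReal_add, Complex.add_im, Complex.sub_im, hHx,
      Complex.im_mul_ofReal, Complex.im_mul_ofReal]
    simp
    ring
  have habs : Y.im * ‖x‖ ^ 2 + γ * (‖p‖ ^ 2 + ‖q‖ ^ 2) ≤ ‖x‖ * ‖v‖ := by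
    have h3 := (Complex.abs_im_le_norm (inner ℂ x v)).trans (norm_inner_le_norm x v)
    have h4 := abs_le.mp h3
    rcases hε with rfl | rfl
    · linarith [h4.2]
    · linarith [h4.1]
  have hlow : ‖x‖ ^ 2 ≤ 2592 * (‖p‖ ^ 2 + ‖q‖ ^ 2) := by
    have h5 : ‖x‖ ≤ 12 * (3 * ‖p‖ + 3 * ‖q‖) := by
      refine (hS x).trans ?_
      gcongr
      exact (norm_add_le _ _).trans (add_le_add (W₁.le_of_opNorm_le h1 p) (W₂.le_of_opNorm_le h2 q))
    have := pow_le_pow_left₀ (norm_nonneg x) h5 2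
    nlinarith [sq_nonneg (‖p‖ - ‖q‖)]
  have h6 : ‖x‖ * (γ / 2592 * ‖x‖) ≤ ‖x‖ * ‖v‖ := by
    have : 0 ≤ Y.im * ‖x‖ ^ 2 := by positivity
    have := mul_le_mul_of_nonneg_left hlow hγ.le
    nlinarith
  rcases (norm_nonneg x).eq_or_lt with h | h
  · rw [← h]; simp
  · exact le_of_mul_le_mul_left h6 h

lemma four_tri {K : ℝ} {u₁ u₂ u₃ u₄ u : E} (h : u = u₁ + u₂ + u₃ + u₄)
    (hb : ‖u₁‖ + ‖u₂‖ + ‖u₃‖ + ‖u₄‖ ≤ K) : ‖u‖ ≤ K := by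
  rw [h]
  exact (norm_add₄_le).trans hb

open ContinuousLinearMap in
lemma core (γ : ℝ) (hγ : 0 < γ) (H W₁ W₂ : E →L[ℂ] E) (hH : adjoint H = H)
    (h1 : ‖W₁‖ ≤ 3) (h2 : ‖W₂‖ ≤ 3)
    (hS : ∀ x, ‖x‖ ≤ 12 * ‖W₁ (adjoint W₁ x) + W₂ (adjoint W₂ x)‖)
    (Y : ℂ) (hY : 0 ≤ Y.im) (x1 x2 x3 x4 x5 x6 x7 x8 y2 y3 y4 y5 y6 y7 y8 : E)
    (k7 k8 : ℝ) (hk7 : k7 = (4 + 6 * γ) / (γ / 2592))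
    (hk8 : k8 = (1 + 6 * γ + 12 * γ ^ 2 + 36 * γ ^ 2 * k7) / (γ / 2592))
    (e2 : (Complex.I / γ) • x3 + adjoint W₂ x8 = y2)
    (e3 : -((Complex.I / γ) • x2) + adjoint W₂ x7 = y3)
    (e4 : (Complex.I / γ) • x6 + adjoint W₁ x8 = y4)
    (e5 : -((1 / (4 * (γ : ℂ) ^ 2)) • x5) + adjoint W₁ x7 = y5)
    (e6 : -((Complex.I / γ) • x4) + adjoint W₁ x7 = y6)
    (e7 : W₂ x3 + W₁ x5 + W₁ x6 + (Y • x8 - H x8) = y7)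
    (e8 : W₂ x1 + W₂ x2 + W₁ x4 + ((starRingEnd ℂ Y) • x7 - H x7) = y8)
    (s a : ℝ) (ha : 0 ≤ a) (hs : s = a + ‖x1‖)
    (b2 : ‖y2‖ ≤ a) (b3 : ‖y3‖ ≤ a) (b4 : ‖y4‖ ≤ a) (b5 : ‖y5‖ ≤ a) (b6 : ‖y6‖ ≤ a)
    (b7 : ‖y7‖ ≤ a) (b8 : ‖y8‖ ≤ a) :
    ‖x1‖ + ‖x2‖ + ‖x3‖ + ‖x4‖ + ‖x5‖ + ‖x6‖ + ‖x7‖ + ‖x8‖ ≤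
      (1 + 2 * (γ * (1 + 3 * k7)) + 2 * (γ * (1 + 3 * k8)) + 4 * γ ^ 2 * (1 + 3 * k7)
        + k7 + k8) * s := by
  have hγ' : (γ : ℂ) ≠ 0 := by exact_mod_cast hγ.ne'
  have n1 := fun v => W₁.le_of_opNorm_le h1 v
  have n2 := fun v => W₂.le_of_opNorm_le h2 v
  have m1 := fun v => (adjoint W₁).le_of_opNorm_le (c := 3)
    (by rw [LinearIsometryEquiv.norm_map]; exact h1) v
  have m2 := fun v => (adjoint W₂).le_of_opNorm_le (c := 3)
    (by rw [LinearIsometryEquiv.norm_map]; exact h2) v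
  have i1 : (γ : ℂ) * Complex.I * (Complex.I / γ) = -1 := by
    field_simp; simp
  have f3 : x3 = (-(γ * Complex.I)) • (y2 - adjoint W₂ x8) := by
    rw [← e2, add_sub_cancel_right, smul_smul, neg_mul, i1]; simp
  have f6 : x6 = (-(γ * Complex.I)) • (y4 - adjoint W₁ x8) := by
    rw [← e4, add_sub_cancel_right, smul_smul, neg_mul, i1]; simp
  have f2 : x2 = (γ * Complex.I) • (y3 - adjoint W₂ x7) := by
    rw [← e3, add_sub_cancel_right, smul_neg, smul_smul, i1]; simp
  have f4 : x4 = (γ * Complex.I) • (y6 - adjoint W₁ x7) := by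
    rw [← e6, add_sub_cancel_right, smul_neg, smul_smul, i1]; simp
  have f5 : x5 = (-(4 * (γ : ℂ) ^ 2)) • (y5 - adjoint W₁ x7) := by
    rw [← e5, add_sub_cancel_right, smul_neg, smul_smul, neg_mul, mul_one_div_cancel]
    · simp
    · simp [hγ']
  have ng : ‖(γ : ℂ) * Complex.I‖ = γ := by simp [abs_of_pos hγ]
  have ng4 : ‖(4 * (γ : ℂ) ^ 2)‖ = 4 * γ ^ 2 := by simp
  have hs0 : 0 ≤ s := by rw [hs]; positivity
  have has : a ≤ s := by rw [hs]; linarith [norm_nonneg x1]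
  have hxs : ‖x1‖ ≤ s := by rw [hs]; linarith
  have c7 := coerc γ hγ H W₁ W₂ hH h1 h2 hS Y hY (-1) (Or.inr rfl) x7
  have c8 := coerc γ hγ H W₁ W₂ hH h1 h2 hS Y hY 1 (Or.inl rfl) x8
  have hY1 : (Y.re : ℂ) + ((1 : ℝ) : ℂ) * Y.im * Complex.I = Y := by
    simp [Complex.re_add_im]
  have hY2 : (Y.re : ℂ) + ((-1 : ℝ) : ℂ) * Y.im * Complex.I = starRingEnd ℂ Y := by
    apply Complex.ext <;> simp
  rw [hY2] at c7
  rw [hY1] at c8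
  have d7 : ‖x7‖ ≤ k7 * s := by
    rw [hk7, div_mul_eq_mul_div, le_div_iff₀ (by positivity), mul_comm]
    refine c7.trans (four_tri (u₁ := y8) (u₂ := -W₂ x1) (u₃ := -((γ * Complex.I) • W₂ y3))
      (u₄ := -((γ * Complex.I) • W₁ y6)) ?_ ?_)
    · rw [← e8, f2, f4]
      simp only [map_sub, map_smul]
      push_cast
      module
    · simp only [norm_neg, norm_smul, ng]
      have := n2 x1
      have := mul_le_mul_of_nonneg_left ((n2 y3).trans (mul_le_mul_of_nonneg_left (b3.trans has) (by norm_num))) hγ.le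
      have := mul_le_mul_of_nonneg_left ((n1 y6).trans (mul_le_mul_of_nonneg_left (b6.trans has) (by norm_num))) hγ.le
      linarith
  have d8 : ‖x8‖ ≤ k8 * s := by
    rw [hk8, div_mul_eq_mul_div, le_div_iff₀ (by positivity), mul_comm]
    refine c8.trans (four_tri (u₁ := y7) (u₂ := (γ * Complex.I) • W₂ y2)
      (u₃ := (γ * Complex.I) • W₁ y4)
      (u₄ := (4 * (γ : ℂ) ^ 2) • W₁ (y5 - adjoint W₁ x7)) ?_ ?_)
    · rw [← e7, f3, f6, f5]
      simp only [map_sub, map_smul]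
      push_cast
      module
    · simp only [norm_smul, ng, ng4]
      have := mul_le_mul_of_nonneg_left ((n2 y2).trans (mul_le_mul_of_nonneg_left (b2.trans has) (by norm_num))) hγ.le
      have := mul_le_mul_of_nonneg_left ((n1 y4).trans (mul_le_mul_of_nonneg_left (b4.trans has) (by norm_num))) hγ.le
      have h9 : ‖W₁ (y5 - adjoint W₁ x7)‖ ≤ 3 * (s + 3 * (k7 * s)) := by
        refine (n1 _).trans ?_
        have := norm_sub_le y5 (adjoint W₁ x7)
        have := m1 x7
        linarith
      have := mul_le_mul_of_nonneg_left h9 (by positivity : 0 ≤ 4 * γ ^ 2)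
      linarith
  have d2 : ‖x2‖ ≤ γ * (1 + 3 * k7) * s := by
    rw [f2, norm_smul, ng, mul_assoc]
    gcongr
    linarith [norm_sub_le y3 (adjoint W₂ x7), m2 x7]
  have d4 : ‖x4‖ ≤ γ * (1 + 3 * k7) * s := by
    rw [f4, norm_smul, ng, mul_assoc]
    gcongr
    linarith [norm_sub_le y6 (adjoint W₁ x7), m1 x7]
  have d3 : ‖x3‖ ≤ γ * (1 + 3 * k8) * s := by
    rw [f3, norm_smul, norm_neg, ng, mul_assoc]
    gcongr
    linarith [norm_sub_le y2 (adjoint W₂ x8), m2 x8]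
  have d6 : ‖x6‖ ≤ γ * (1 + 3 * k8) * s := by
    rw [f6, norm_smul, norm_neg, ng, mul_assoc]
    gcongr
    linarith [norm_sub_le y4 (adjoint W₁ x8), m1 x8]
  have d5 : ‖x5‖ ≤ 4 * γ ^ 2 * (1 + 3 * k7) * s := by
    rw [f5, norm_smul, norm_neg, ng4, mul_assoc (4 * γ ^ 2) (1 + 3 * k7) s]
    refine mul_le_mul_of_nonneg_left ?_ (by positivity)
    linarith [norm_sub_le y5 (adjoint W₁ x7), m1 x7]
  linarith

end core

/-- block component of a vector -/
def blk {N : ℕ} (x : EuclideanSpace ℂ (Fin 8 × Fin N)) (i : Fin 8) : EuclideanSpace ℂ (Fin N) :=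
  WithLp.toLp 2 fun k => x (i, k)

lemma norm_sq_blk {N : ℕ} (x : EuclideanSpace ℂ (Fin 8 × Fin N)) :
    ‖x‖ ^ 2 = ∑ i, ‖blk x i‖ ^ 2 := by
  simp only [EuclideanSpace.norm_sq_eq, Fintype.sum_prod_type, blk]

lemma norm_blk_le {N : ℕ} (x : EuclideanSpace ℂ (Fin 8 × Fin N)) (i : Fin 8) :
    ‖blk x i‖ ≤ ‖x‖ := by
  refine le_of_sq_le_sq ?_ (norm_nonneg _)
  rw [norm_sq_blk x]
  exact Finset.single_le_sum (f := fun i => ‖blk x i‖ ^ 2) (fun _ _ => by positivity)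
    (Finset.mem_univ i)

lemma norm_le_blk {N : ℕ} (x : EuclideanSpace ℂ (Fin 8 × Fin N)) :
    ‖x‖ ≤ ∑ i, ‖blk x i‖ := by
  refine le_of_sq_le_sq ?_ (by positivity)
  rw [norm_sq_blk x]
  exact Finset.sum_sq_le_sq_sum_of_nonneg (fun _ _ => norm_nonneg _)

lemma blk_mul {N : ℕ} (B : Matrix (Fin 8) (Fin 8) (Matrix (Fin N) (Fin N) ℂ))
    (x : EuclideanSpace ℂ (Fin 8 × Fin N)) (i : Fin 8) :
    blk (Matrix.toEuclideanCLM (𝕜 := ℂ) (fun p q : Fin 8 × Fin N => B p.1 q.1 p.2 q.2) x) i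
      = ∑ j, Matrix.toEuclideanCLM (𝕜 := ℂ) (B i j) (blk x j) := by
  ext k
  refine (congrFun (Matrix.ofLp_toEuclideanCLM (𝕜 := ℂ)
    (fun p q : Fin 8 × Fin N => B p.1 q.1 p.2 q.2) x) (i, k)).trans ?_
  simp only [blk, Matrix.ofLp_toEuclideanCLM, WithLp.ofLp_sum, Finset.sum_apply]
  simp only [Matrix.mulVec, dotProduct, Fintype.sum_prod_type]

lemma blk_J {N : ℕ} (x : EuclideanSpace ℂ (Fin 8 × Fin N)) (p : Fin 8 × Fin N) :
    (Matrix.toEuclideanCLM (𝕜 := ℂ) (Jmat N) x) p = if p.1 = 0 then x p else 0 := by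
  obtain ⟨i, k⟩ := p
  by_cases hi : i = 0
  · simp [hi, Jmat, Matrix.mulVec, dotProduct, Fintype.sum_prod_type, Matrix.ofLp_toEuclideanCLM,
      Matrix.one_apply]
  · simp [hi, Jmat, Matrix.mulVec, dotProduct, Fintype.sum_prod_type, Matrix.ofLp_toEuclideanCLM]

lemma inner_J {N : ℕ} (x : EuclideanSpace ℂ (Fin 8 × Fin N)) :
    inner ℂ x (Matrix.toEuclideanCLM (𝕜 := ℂ) (Jmat N) x) = ((‖blk x 0‖ ^ 2 : ℝ) : ℂ) := by
  rw [PiLp.inner_apply, EuclideanSpace.norm_sq_eq, Fintype.sum_prod_type]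
  simp only [blk_J]
  rw [Finset.sum_eq_single 0]
  · simp [blk, Complex.mul_conj, Complex.normSq_eq_norm_sq]
  · intro b _ hb; simp [hb]
  · simp

lemma herm_of_blocks {N : ℕ} (B : Matrix (Fin 8) (Fin 8) (Matrix (Fin N) (Fin N) ℂ))
    (h : ∀ i j, (B j i)ᴴ = B i j) :
    Matrix.IsHermitian (fun p q : Fin 8 × Fin N => B p.1 q.1 p.2 q.2) := by
  ext p q
  exact congrFun (congrFun (h p.1 q.1) p.2) q.2

lemma linMat_herm (N : ℕ) (γ : ℝ) (Y : ℂ) (H W₁ W₂ : Matrix (Fin N) (Fin N) ℂ)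
    (hH : H.IsHermitian) : (linMat N γ Y H W₁ W₂).IsHermitian := by
  have h1 := hH.eq
  refine herm_of_blocks _ fun i j => ?_
  fin_cases i <;> fin_cases j <;> simp [h1, neg_div]

lemma im_inner_lin (N : ℕ) (γ : ℝ) (Y : ℂ) (H W₁ W₂ : Matrix (Fin N) (Fin N) ℂ)
    (hH : H.IsHermitian) (x : EuclideanSpace ℂ (Fin 8 × Fin N)) :
    (inner ℂ x (Matrix.toEuclideanCLM (𝕜 := ℂ) (linMat N γ Y H W₁ W₂) x)).im = 0 := by
  set T := Matrix.toEuclideanCLM (𝕜 := ℂ) (linMat N γ Y H W₁ W₂) with hT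
  have hs : star T = T := by
    rw [hT, ← map_star, Matrix.star_eq_conjTranspose, (linMat_herm N γ Y H W₁ W₂ hH).eq]
  rw [ContinuousLinearMap.star_eq_adjoint] at hs
  have : (starRingEnd ℂ) (inner ℂ x (T x)) = inner ℂ x (T x) := by
    rw [inner_conj_symm]
    conv_rhs => rw [← hs, ContinuousLinearMap.adjoint_inner_right]
  exact Complex.conj_eq_iff_im.mp this

lemma scalar_end (t a b K η : ℝ) (ht : 0 ≤ t) (ha : 0 ≤ a) (hb : 0 ≤ b) (hK : 1 ≤ K)
    (hη : 0 < η) (h1 : η * b ^ 2 ≤ t * a) (h2 : t ≤ K * (a + b)) :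
    t ≤ 2 * K ^ 2 * (1 + 1 / η) * a := by
  have hi : 0 < 1 / η := by positivity
  have hK2 : 1 ≤ K ^ 2 := one_le_pow₀ hK
  rcases le_or_gt t a with h | h
  · have h3 : 1 ≤ 2 * K ^ 2 * (1 + 1 / η) := by nlinarith
    nlinarith
  · have hb2 : b ^ 2 ≤ 1 / η * (t * a) := by
      rw [one_div, ← div_eq_inv_mul, le_div_iff₀ hη]; linarith
    have ht2 : t ^ 2 ≤ K ^ 2 * (a + b) ^ 2 := by
      rw [← mul_pow]; exact pow_le_pow_left₀ ht h2 2
    have h4 : (a + b) ^ 2 ≤ 2 * (t * a + 1 / η * (t * a)) := by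
      nlinarith [sq_nonneg (a - b)]
    have h5 := ht2.trans (mul_le_mul_of_nonneg_left h4 (by positivity))
    have htp : 0 < t := lt_of_le_of_lt ha h
    refine le_of_mul_le_mul_left ?_ htp
    linarith

lemma vec_bound (γ : ℝ) (hγ : 0 < γ) (k7 k8 K : ℝ) (hk7 : k7 = (4 + 6 * γ) / (γ / 2592))
    (hk8 : k8 = (1 + 6 * γ + 12 * γ ^ 2 + 36 * γ ^ 2 * k7) / (γ / 2592))
    (hK : K = 1 + 2 * (γ * (1 + 3 * k7)) + 2 * (γ * (1 + 3 * k8)) + 4 * γ ^ 2 * (1 + 3 * k7)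
        + k7 + k8)
    (N : ℕ) (H W₁ W₂ : Matrix (Fin N) (Fin N) ℂ) (hH : H.IsHermitian)
    (h1 : opNorm W₁ ≤ 3) (h2 : opNorm W₂ ≤ 3)
    (hdet : IsUnit (W₁ * W₁ᴴ + W₂ * W₂ᴴ).det)
    (hinv : opNorm (W₁ * W₁ᴴ + W₂ * W₂ᴴ)⁻¹ ≤ 12)
    (Y z : ℂ) (hY : 0 ≤ Y.im) (hz : 0 < z.im) (x : EuclideanSpace ℂ (Fin 8 × Fin N)) :
    ‖x‖ ≤ 2 * K ^ 2 * (1 + 1 / z.im) *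
      ‖Matrix.toEuclideanCLM (𝕜 := ℂ) (linMat N γ Y H W₁ W₂ - z • Jmat N) x‖ := by
  set T := Matrix.toEuclideanCLM (n := Fin N) (𝕜 := ℂ) with hT
  have hadj : ∀ A, ContinuousLinearMap.adjoint (T A) = T Aᴴ := by
    intro A
    rw [← ContinuousLinearMap.star_eq_adjoint, ← map_star, Matrix.star_eq_conjTranspose]
  set y := Matrix.toEuclideanCLM (𝕜 := ℂ) (linMat N γ Y H W₁ W₂ - z • Jmat N) x with hy
  set w := Matrix.toEuclideanCLM (𝕜 := ℂ) (linMat N γ Y H W₁ W₂) x with hw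
  have hyw : y = w - z • Matrix.toEuclideanCLM (𝕜 := ℂ) (Jmat N) x := by
    rw [hy, hw, map_sub, map_smul]; rfl
  have him : z.im * ‖blk x 0‖ ^ 2 ≤ ‖x‖ * ‖y‖ := by
    have h3 := (Complex.abs_im_le_norm (inner ℂ x y)).trans (norm_inner_le_norm x y)
    rw [hyw, inner_sub_right, inner_smul_right, inner_J, Complex.sub_im, Complex.im_mul_ofReal,
      im_inner_lin N γ Y H W₁ W₂ hH x, ← hyw, zero_sub, abs_neg] at h3
    exact (le_abs_self _).trans h3
  have hblk : ∀ i, i ≠ 0 → blk w i = blk y i := by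
    intro i hi
    ext k
    simp [blk, hyw, blk_J, hi]
  have hrow := fun i => blk_mul (N := N) _ x i |>.symm.trans
    (show _ = blk w i from rfl)
  have hS : ∀ v, ‖v‖ ≤ 12 * ‖(T W₁) (ContinuousLinearMap.adjoint (T W₁) v)
      + (T W₂) (ContinuousLinearMap.adjoint (T W₂) v)‖ := by
    intro v
    have h3 : (T W₁) (ContinuousLinearMap.adjoint (T W₁) v)
      + (T W₂) (ContinuousLinearMap.adjoint (T W₂) v) = T (W₁ * W₁ᴴ + W₂ * W₂ᴴ) v := by
      rw [hadj, hadj, map_add, map_mul, map_mul]; rfl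
    have h4 : v = T (W₁ * W₁ᴴ + W₂ * W₂ᴴ)⁻¹ (T (W₁ * W₁ᴴ + W₂ * W₂ᴴ) v) := by
      rw [← mul_apply_eq_comp, ← map_mul, Matrix.nonsing_inv_mul _ hdet, map_one]; rfl
    rw [h3]
    conv_lhs => rw [h4]
    exact ContinuousLinearMap.le_of_opNorm_le _ hinv _
  have T0 : T 0 = 0 := map_zero T
  have T1 : T 1 = 1 := map_one T
  have r := fun i (hi : i ≠ 0) => (hrow i).trans (hblk i hi)
  have hb := norm_blk_le y
  have hcore := core γ hγ (T H) (T W₁) (T W₂) (by rw [hadj, hH.eq]) h1 h2 hS Y hY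
    (blk x 0) (blk x 1) (blk x 2) (blk x 3) (blk x 4) (blk x 5) (blk x 6) (blk x 7)
    (blk y 1) (blk y 2) (blk y 3) (blk y 4) (blk y 5) (blk y 6) (blk y 7)
    k7 k8 hk7 hk8
    (by rw [← r 1 (by decide), Fin.sum_univ_eight]; simp [T0, T1, ← hT, hadj])
    (by rw [← r 2 (by decide), Fin.sum_univ_eight]; simp [T0, T1, ← hT, hadj])
    (by rw [← r 3 (by decide), Fin.sum_univ_eight]; simp [T0, T1, ← hT, hadj])
    (by rw [← r 4 (by decide), Fin.sum_univ_eight]; simp [T0, T1, ← hT, hadj])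
    (by rw [← r 5 (by decide), Fin.sum_univ_eight]; simp [T0, T1, ← hT, hadj])
    (by rw [← r 6 (by decide), Fin.sum_univ_eight]; simp [T0, T1, ← hT, hadj])
    (by rw [← r 7 (by decide), Fin.sum_univ_eight]; simp [T0, T1, ← hT, hadj])
    _ ‖y‖ (norm_nonneg _) rfl (hb 1) (hb 2) (hb 3) (hb 4) (hb 5) (hb 6) (hb 7)
  rw [← hK] at hcore
  have hx := norm_le_blk x
  rw [Fin.sum_univ_eight] at hx
  have hx' := hx.trans hcore
  have hk7p : 0 ≤ k7 := by rw [hk7]; positivity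
  have hk8p : 0 ≤ k8 := by rw [hk8]; positivity
  have hK1 : 1 ≤ K := by
    have : 0 ≤ 2 * (γ * (1 + 3 * k7)) + 2 * (γ * (1 + 3 * k8)) + 4 * γ ^ 2 * (1 + 3 * k7)
        + k7 + k8 := by positivity
    linarith
  -- final scalar argument
  exact scalar_end ‖x‖ ‖y‖ ‖blk x 0‖ K z.im (norm_nonneg _) (norm_nonneg _) (norm_nonneg _)
    hK1 hz him hx'

/-- **A priori bound on the generalized resolvent (Lemma 2.1(i)).**
For every `γ > 0` there is a dimension-independent constant `C > 0` such that on the event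
`‖H‖, ‖W₁‖, ‖W₂‖ ≤ 3` and `‖(W₁W₁ᴴ + W₂W₂ᴴ)⁻¹‖ ≤ 12`, for all `𝒴` with `Im 𝒴 ≥ 0` and `z` with
`Im z > 0`, the matrix `𝐇_𝒴 − z•(J₈ ⊗ 1_N)` is invertible and its inverse has norm at most
`C·(1 + 1/Im z)`. -/
theorem generalized_resolvent_apriori_bound (γ : ℝ) (hγ : 0 < γ) :
    ∃ C : ℝ, 0 < C ∧
      ∀ (N : ℕ), 1 ≤ N →
        ∀ (H W₁ W₂ : Matrix (Fin N) (Fin N) ℂ), H.IsHermitian →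
          opNorm H ≤ 3 → opNorm W₁ ≤ 3 → opNorm W₂ ≤ 3 →
          IsUnit (W₁ * W₁ᴴ + W₂ * W₂ᴴ).det →
          opNorm (W₁ * W₁ᴴ + W₂ * W₂ᴴ)⁻¹ ≤ 12 →
          ∀ (𝒴 z : ℂ), 0 ≤ 𝒴.im → 0 < z.im →
            IsUnit (linMat N γ 𝒴 H W₁ W₂ - z • Jmat N).det ∧
            opNorm ((linMat N γ 𝒴 H W₁ W₂ - z • Jmat N)⁻¹) ≤ C * (1 + 1 / z.im) := by
  set k7 : ℝ := (4 + 6 * γ) / (γ / 2592) with hk7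
  set k8 : ℝ := (1 + 6 * γ + 12 * γ ^ 2 + 36 * γ ^ 2 * k7) / (γ / 2592) with hk8
  set K : ℝ := 1 + 2 * (γ * (1 + 3 * k7)) + 2 * (γ * (1 + 3 * k8)) + 4 * γ ^ 2 * (1 + 3 * k7)
        + k7 + k8 with hK
  have hk7p : 0 ≤ k7 := by rw [hk7]; positivity
  have hk8p : 0 ≤ k8 := by rw [hk8]; positivity
  have hKp : 0 < K := by rw [hK]; positivity
  refine ⟨2 * K ^ 2, by positivity, ?_⟩
  intro N _ H W₁ W₂ hH _ h1 h2 hdet hinv Y z hY hz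
  have hv := vec_bound γ hγ k7 k8 K hk7 hk8 hK N H W₁ W₂ hH h1 h2 hdet hinv Y z hY hz
  clear_value K
  set M := linMat N γ Y H W₁ W₂ - z • Jmat N with hM
  have hu : IsUnit M.det := by
    rw [isUnit_iff_ne_zero]
    intro h0
    obtain ⟨v, hv0, hv1⟩ := Matrix.exists_mulVec_eq_zero_iff.mpr h0
    have h3 := hv (WithLp.toLp 2 v)
    rw [Matrix.toEuclideanCLM_toLp, hv1] at h3
    simp at h3
    exact hv0 h3
  refine ⟨hu, ?_⟩
  refine ContinuousLinearMap.opNorm_le_bound _ (by positivity) fun y => ?_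
  have h3 := hv (Matrix.toEuclideanCLM (𝕜 := ℂ) M⁻¹ y)
  rwa [← mul_apply_eq_comp (Matrix.toEuclideanCLM (𝕜 := ℂ) M), ← map_mul,
    Matrix.mul_nonsing_inv _ hu, map_one, one_apply_eq_self] at h3

end
end

section
/- Let γ > 0, z, 𝒴 ∈ ℂ, and let M ∈ Matrix (Fin 8) (Fin 8) ℂ be invertible and satisfy the Dyson equation for the linearization: −M⁻¹ = z•J₈ − K₀(𝒴) + Γ[M]. Then M is block diagonal with respect to the partition {1,2,3} ∪ {4,5,6} ∪ {7,8}, i.e. M = blockdiag(M₁, M₂, M₃) with M₁, M₂ ∈ M₃(ℂ) and M₃ ∈ M₂(ℂ); moreover each block is invertible and −M₁⁻¹ = z•J₃ − U₁ + U₅ᵀ ⬝ M₃ ⬝ U₅, −M₂⁻¹ = −U₂ + U₄ᵀ ⬝ M₃ ⬝ U₄, and −M₃⁻¹ = −U₃(𝒴) + U₅ ⬝ M₁ ⬝ U₅ᵀ + U₄ ⬝ M₂ ⬝ U₄ᵀ + σ₁ ⬝ M₃ ⬝ σ₁. -/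
open Matrix

noncomputable section

def sigma1 : Matrix (Fin 2) (Fin 2) ℂ := !![0, 1; 1, 0]

def U1 (γ : ℝ) : Matrix (Fin 3) (Fin 3) ℂ :=
  !![0, 0, 0;
     0, 0, Complex.I / (γ : ℂ);
     0, -(Complex.I / (γ : ℂ)), 0]

def U2 (γ : ℝ) : Matrix (Fin 3) (Fin 3) ℂ :=
  !![0, 0, Complex.I / (γ : ℂ);
     0, -(1 / (4 * (γ : ℂ) ^ 2)), 0;
     -(Complex.I / (γ : ℂ)), 0, 0]

def U3 (𝒴 : ℂ) : Matrix (Fin 2) (Fin 2) ℂ := !![0, 𝒴; starRingEnd ℂ 𝒴, 0]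

def U4 : Matrix (Fin 2) (Fin 3) ℂ := !![0, 1, 1; 1, 0, 0]

def U5 : Matrix (Fin 2) (Fin 3) ℂ := !![0, 0, 1; 1, 1, 0]

/-- `K₀(𝒴) = blockdiag(U₁, U₂, U₃(𝒴)) ∈ M₈(ℂ)`. -/
def K0 (γ : ℝ) (𝒴 : ℂ) : Matrix (Fin 8) (Fin 8) ℂ :=
  !![0, 0, 0, 0, 0, 0, 0, 0;
     0, 0, Complex.I / (γ : ℂ), 0, 0, 0, 0, 0;
     0, -(Complex.I / (γ : ℂ)), 0, 0, 0, 0, 0, 0;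
     0, 0, 0, 0, 0, Complex.I / (γ : ℂ), 0, 0;
     0, 0, 0, 0, -(1 / (4 * (γ : ℂ) ^ 2)), 0, 0, 0;
     0, 0, 0, -(Complex.I / (γ : ℂ)), 0, 0, 0, 0;
     0, 0, 0, 0, 0, 0, 0, 𝒴;
     0, 0, 0, 0, 0, 0, starRingEnd ℂ 𝒴, 0]

/-- `K₁ ∈ M₈(ℂ)` : lower-right `2 × 2` block (rows and columns 7,8) equals `−σ₁`. -/
def K1 : Matrix (Fin 8) (Fin 8) ℂ :=
  !![0, 0, 0, 0, 0, 0, 0, 0;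
     0, 0, 0, 0, 0, 0, 0, 0;
     0, 0, 0, 0, 0, 0, 0, 0;
     0, 0, 0, 0, 0, 0, 0, 0;
     0, 0, 0, 0, 0, 0, 0, 0;
     0, 0, 0, 0, 0, 0, 0, 0;
     0, 0, 0, 0, 0, 0, 0, -1;
     0, 0, 0, 0, 0, 0, -1, 0]

/-- `L₁ ∈ M₈(ℂ)` : block in rows 7–8, columns 4–6 equals `U₄`. -/
def L1 : Matrix (Fin 8) (Fin 8) ℂ :=
  !![0, 0, 0, 0, 0, 0, 0, 0;
     0, 0, 0, 0, 0, 0, 0, 0;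
     0, 0, 0, 0, 0, 0, 0, 0;
     0, 0, 0, 0, 0, 0, 0, 0;
     0, 0, 0, 0, 0, 0, 0, 0;
     0, 0, 0, 0, 0, 0, 0, 0;
     0, 0, 0, 0, 1, 1, 0, 0;
     0, 0, 0, 1, 0, 0, 0, 0]

/-- `L₂ ∈ M₈(ℂ)` : block in rows 7–8, columns 1–3 equals `U₅`. -/
def L2 : Matrix (Fin 8) (Fin 8) ℂ :=
  !![0, 0, 0, 0, 0, 0, 0, 0;
     0, 0, 0, 0, 0, 0, 0, 0;
     0, 0, 0, 0, 0, 0, 0, 0;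
     0, 0, 0, 0, 0, 0, 0, 0;
     0, 0, 0, 0, 0, 0, 0, 0;
     0, 0, 0, 0, 0, 0, 0, 0;
     0, 0, 1, 0, 0, 0, 0, 0;
     1, 1, 0, 0, 0, 0, 0, 0]

/-- The self-energy operator `Γ : M₈(ℂ) → M₈(ℂ)`. -/
def Gamma (R : Matrix (Fin 8) (Fin 8) ℂ) : Matrix (Fin 8) (Fin 8) ℂ :=
  K1 * R * K1 + L1 * R * L1ᴴ + L1ᴴ * R * L1 + L2 * R * L2ᴴ + L2ᴴ * R * L2

/-- `J₈ ∈ M₈(ℂ)` : single `1` in the `(1,1)` entry. -/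
def J8 : Matrix (Fin 8) (Fin 8) ℂ :=
  !![1, 0, 0, 0, 0, 0, 0, 0;
     0, 0, 0, 0, 0, 0, 0, 0;
     0, 0, 0, 0, 0, 0, 0, 0;
     0, 0, 0, 0, 0, 0, 0, 0;
     0, 0, 0, 0, 0, 0, 0, 0;
     0, 0, 0, 0, 0, 0, 0, 0;
     0, 0, 0, 0, 0, 0, 0, 0;
     0, 0, 0, 0, 0, 0, 0, 0]

/-- `J₃ ∈ M₃(ℂ)` : single `1` in the `(1,1)` entry. -/
def J3 : Matrix (Fin 3) (Fin 3) ℂ := !![1, 0, 0; 0, 0, 0; 0, 0, 0]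

/-- Group index of the partition `{1,2,3} ∪ {4,5,6} ∪ {7,8}` of `Fin 8`. -/
def grp8 : Fin 8 → Fin 3 := ![0, 0, 0, 1, 1, 1, 2, 2]

/-- Embedding of the first group. -/
def emb1 : Fin 3 → Fin 8 := ![0, 1, 2]

/-- Embedding of the second group. -/
def emb2 : Fin 3 → Fin 8 := ![3, 4, 5]

/-- Embedding of the third group. -/
def emb3 : Fin 2 → Fin 8 := ![6, 7]


lemma comm_off (M N : Matrix (Fin 8) (Fin 8) ℂ) (h1 : M * N = -1) (h2 : N * M = -1)
    (hN : ∀ i j : Fin 8, grp8 i ≠ grp8 j → N i j = 0) :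
    ∀ i j : Fin 8, grp8 i ≠ grp8 j → M i j = 0 := by
  intro i j hij
  let D : Matrix (Fin 8) (Fin 8) ℂ := diagonal fun i => ((grp8 i : ℕ) : ℂ)
  have hc : N * D = D * N := by
    ext a b
    simp only [D, mul_diagonal, diagonal_mul]
    by_cases h : grp8 a = grp8 b
    · rw [h, mul_comm]
    · rw [hN a b h]; simp
  have hd : M * D = D * M := by
    have e : M * (N * D) * M = M * (D * N) * M := by rw [hc]
    have e1 : M * (N * D) * M = -(D * M) := by
      rw [← mul_assoc M N D, h1]; simp
    have e2 : M * (D * N) * M = -(M * D) := by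
      rw [mul_assoc, mul_assoc, h2]; simp
    rw [e1, e2] at e
    exact (neg_injective e).symm
  have := congrFun (congrFun hd i) j
  simp only [D, mul_diagonal, diagonal_mul] at this
  have h3 : M i j * (((grp8 j : ℕ) : ℂ) - ((grp8 i : ℕ) : ℂ)) = 0 := by
    rw [mul_sub, this]; ring
  rcases mul_eq_zero.mp h3 with h | h
  · exact h
  · exfalso
    apply hij
    have : ((grp8 j : ℕ) : ℂ) = ((grp8 i : ℕ) : ℂ) := sub_eq_zero.mp h
    exact Fin.ext (Nat.cast_injective this).symm

lemma K1_l (X : Matrix (Fin 8) (Fin 8) ℂ) (i j : Fin 8) :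
    (K1 * X) i j = (![0, 0, 0, 0, 0, 0, -X 7 j, -X 6 j] : Fin 8 → ℂ) i := by
  rw [mul_apply, Fin.sum_univ_eight]
  fin_cases i <;> simp [K1]

lemma K1_r (X : Matrix (Fin 8) (Fin 8) ℂ) (i j : Fin 8) :
    (X * K1) i j = (![0, 0, 0, 0, 0, 0, -X i 7, -X i 6] : Fin 8 → ℂ) j := by
  rw [mul_apply, Fin.sum_univ_eight]
  fin_cases j <;> simp [K1]

lemma L1_l (X : Matrix (Fin 8) (Fin 8) ℂ) (i j : Fin 8) :
    (L1 * X) i j = (![0, 0, 0, 0, 0, 0, X 4 j + X 5 j, X 3 j] : Fin 8 → ℂ) i := by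
  rw [mul_apply, Fin.sum_univ_eight]
  fin_cases i <;> simp [L1]

lemma L1_r (X : Matrix (Fin 8) (Fin 8) ℂ) (i j : Fin 8) :
    (X * L1) i j = (![0, 0, 0, X i 7, X i 6, X i 6, 0, 0] : Fin 8 → ℂ) j := by
  rw [mul_apply, Fin.sum_univ_eight]
  fin_cases j <;> simp [L1]

lemma L1H_l (X : Matrix (Fin 8) (Fin 8) ℂ) (i j : Fin 8) :
    (L1ᴴ * X) i j = (![0, 0, 0, X 7 j, X 6 j, X 6 j, 0, 0] : Fin 8 → ℂ) i := by
  rw [mul_apply, Fin.sum_univ_eight]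
  fin_cases i <;> simp [L1, conjTranspose_apply]

lemma L1H_r (X : Matrix (Fin 8) (Fin 8) ℂ) (i j : Fin 8) :
    (X * L1ᴴ) i j = (![0, 0, 0, 0, 0, 0, X i 4 + X i 5, X i 3] : Fin 8 → ℂ) j := by
  rw [mul_apply, Fin.sum_univ_eight]
  fin_cases j <;> simp [L1, conjTranspose_apply]

lemma L2_l (X : Matrix (Fin 8) (Fin 8) ℂ) (i j : Fin 8) :
    (L2 * X) i j = (![0, 0, 0, 0, 0, 0, X 2 j, X 0 j + X 1 j] : Fin 8 → ℂ) i := by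
  rw [mul_apply, Fin.sum_univ_eight]
  fin_cases i <;> simp [L2]

lemma L2_r (X : Matrix (Fin 8) (Fin 8) ℂ) (i j : Fin 8) :
    (X * L2) i j = (![X i 7, X i 7, X i 6, 0, 0, 0, 0, 0] : Fin 8 → ℂ) j := by
  rw [mul_apply, Fin.sum_univ_eight]
  fin_cases j <;> simp [L2]

lemma L2H_l (X : Matrix (Fin 8) (Fin 8) ℂ) (i j : Fin 8) :
    (L2ᴴ * X) i j = (![X 7 j, X 7 j, X 6 j, 0, 0, 0, 0, 0] : Fin 8 → ℂ) i := by
  rw [mul_apply, Fin.sum_univ_eight]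
  fin_cases i <;> simp [L2, conjTranspose_apply]

lemma L2H_r (X : Matrix (Fin 8) (Fin 8) ℂ) (i j : Fin 8) :
    (X * L2ᴴ) i j = (![0, 0, 0, 0, 0, 0, X i 2, X i 0 + X i 1] : Fin 8 → ℂ) j := by
  rw [mul_apply, Fin.sum_univ_eight]
  fin_cases j <;> simp [L2, conjTranspose_apply]

lemma Gamma_apply (M : Matrix (Fin 8) (Fin 8) ℂ) (i j : Fin 8) :
    Gamma M i j = (![![M 7 7, M 7 7, M 7 6, 0, 0, 0, 0, 0], ![M 7 7, M 7 7, M 7 6, 0, 0, 0, 0, 0],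
      ![M 6 7, M 6 7, M 6 6, 0, 0, 0, 0, 0],
      ![0,0,0, M 7 7, M 7 6, M 7 6, 0, 0],
      ![0,0,0, M 6 7, M 6 6, M 6 6, 0, 0], ![0,0,0, M 6 7, M 6 6, M 6 6, 0, 0],
      ![0,0,0,0,0,0, M 7 7 + (M 4 4 + M 5 4 + (M 4 5 + M 5 5)) + M 2 2,
        M 7 6 + (M 4 3 + M 5 3) + (M 2 0 + M 2 1)],
      ![0,0,0,0,0,0, M 6 7 + (M 3 4 + M 3 5) + (M 0 2 + M 1 2),
        M 6 6 + M 3 3 + (M 0 0 + M 1 0 + (M 0 1 + M 1 1))]] : Fin 8 → Fin 8 → ℂ) i j := by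
  simp only [Gamma, Matrix.add_apply, K1_r, L1_r, L2_r, L1H_r, L2H_r,
    K1_l, L1_l, L2_l, L1H_l, L2H_l]
  fin_cases i <;> fin_cases j <;> simp

lemma block_fin {n : ℕ} (A B : Matrix (Fin n) (Fin n) ℂ) (h : A * B = -1) :
    IsUnit A.det ∧ -A⁻¹ = B := by
  have h' : A * (-B) = 1 := by rw [mul_neg, h, neg_neg]
  refine ⟨isUnit_det_of_right_inverse h', ?_⟩
  rw [inv_eq_right_inv h', neg_neg]

set_option maxHeartbeats 4000000 in
/-- **Block-diagonal structure of solutions of the Dyson equation for the linearization.**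
Any invertible solution `M` of `−M⁻¹ = z•J₈ − K₀(𝒴) + Γ[M]` is block diagonal with respect
to the partition `{1,2,3} ∪ {4,5,6} ∪ {7,8}`, its diagonal blocks `M₁, M₂, M₃` are invertible
and satisfy the reduced system of three matrix equations. -/
theorem dyson_equation_block_diagonal
    (γ : ℝ) (hγ : 0 < γ) (z 𝒴 : ℂ)
    (M : Matrix (Fin 8) (Fin 8) ℂ) (hM : IsUnit M.det)
    (hDEL : -M⁻¹ = z • J8 - K0 γ 𝒴 + Gamma M) :
    (∀ i j : Fin 8, grp8 i ≠ grp8 j → M i j = 0) ∧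
    IsUnit (M.submatrix emb1 emb1).det ∧
    IsUnit (M.submatrix emb2 emb2).det ∧
    IsUnit (M.submatrix emb3 emb3).det ∧
    -(M.submatrix emb1 emb1)⁻¹ = z • J3 - U1 γ + U5ᵀ * (M.submatrix emb3 emb3) * U5 ∧
    -(M.submatrix emb2 emb2)⁻¹ = -(U2 γ) + U4ᵀ * (M.submatrix emb3 emb3) * U4 ∧
    -(M.submatrix emb3 emb3)⁻¹ = -(U3 𝒴) + U5 * (M.submatrix emb1 emb1) * U5ᵀ
        + U4 * (M.submatrix emb2 emb2) * U4ᵀ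
        + sigma1 * (M.submatrix emb3 emb3) * sigma1 := by
  set N := z • J8 - K0 γ 𝒴 + Gamma M with hNdef
  have h1 : M * N = -1 := by
    rw [← hDEL, mul_neg, mul_nonsing_inv _ hM]
  have h2 : N * M = -1 := by
    rw [← hDEL, neg_mul, nonsing_inv_mul _ hM]
  have hN : ∀ i j : Fin 8, grp8 i ≠ grp8 j → N i j = 0 := by
    intro i j hij
    simp only [hNdef, Matrix.add_apply, Matrix.sub_apply, Matrix.smul_apply, Gamma_apply]
    fin_cases i <;> fin_cases j <;> first | (exact absurd rfl hij) | simp [J8, K0]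
  have hoff := comm_off M N h1 h2 hN
  have b1 : M.submatrix emb1 emb1 * N.submatrix emb1 emb1 = -1 := by
    ext i j
    have h := congrFun (congrFun h1 (emb1 i)) (emb1 j)
    rw [mul_apply, Fin.sum_univ_eight] at h
    rw [hoff (emb1 i) 3 (by fin_cases i <;> decide), hoff (emb1 i) 4 (by fin_cases i <;> decide),
      hoff (emb1 i) 5 (by fin_cases i <;> decide), hoff (emb1 i) 6 (by fin_cases i <;> decide),
      hoff (emb1 i) 7 (by fin_cases i <;> decide)] at h
    have e : (-1 : Matrix (Fin 8) (Fin 8) ℂ) (emb1 i) (emb1 j) = (-1 : Matrix (Fin 3) (Fin 3) ℂ) i j := by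
      fin_cases i <;> fin_cases j <;> simp [emb1, one_apply]
    rw [← e, ← h, mul_apply, Fin.sum_univ_three]
    simp [emb1]
  have b2 : M.submatrix emb2 emb2 * N.submatrix emb2 emb2 = -1 := by
    ext i j
    have h := congrFun (congrFun h1 (emb2 i)) (emb2 j)
    rw [mul_apply, Fin.sum_univ_eight] at h
    rw [hoff (emb2 i) 0 (by fin_cases i <;> decide), hoff (emb2 i) 1 (by fin_cases i <;> decide),
      hoff (emb2 i) 2 (by fin_cases i <;> decide), hoff (emb2 i) 6 (by fin_cases i <;> decide),
      hoff (emb2 i) 7 (by fin_cases i <;> decide)] at h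
    have e : (-1 : Matrix (Fin 8) (Fin 8) ℂ) (emb2 i) (emb2 j) = (-1 : Matrix (Fin 3) (Fin 3) ℂ) i j := by
      fin_cases i <;> fin_cases j <;> simp [emb2, one_apply]
    rw [← e, ← h, mul_apply, Fin.sum_univ_three]
    simp [emb2]
  have b3 : M.submatrix emb3 emb3 * N.submatrix emb3 emb3 = -1 := by
    ext i j
    have h := congrFun (congrFun h1 (emb3 i)) (emb3 j)
    rw [mul_apply, Fin.sum_univ_eight] at h
    rw [hoff (emb3 i) 0 (by fin_cases i <;> decide), hoff (emb3 i) 1 (by fin_cases i <;> decide),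
      hoff (emb3 i) 2 (by fin_cases i <;> decide), hoff (emb3 i) 3 (by fin_cases i <;> decide),
      hoff (emb3 i) 4 (by fin_cases i <;> decide), hoff (emb3 i) 5 (by fin_cases i <;> decide)] at h
    have e : (-1 : Matrix (Fin 8) (Fin 8) ℂ) (emb3 i) (emb3 j) = (-1 : Matrix (Fin 2) (Fin 2) ℂ) i j := by
      fin_cases i <;> fin_cases j <;> simp [emb3, one_apply]
    rw [← e, ← h, mul_apply, Fin.sum_univ_two]
    simp [emb3]
  obtain ⟨u1, v1⟩ := block_fin _ _ b1
  obtain ⟨u2, v2⟩ := block_fin _ _ b2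
  obtain ⟨u3, v3⟩ := block_fin _ _ b3
  refine ⟨hoff, u1, u2, u3, ?_, ?_, ?_⟩
  · rw [v1]
    ext i j
    simp only [hNdef, submatrix_apply, Matrix.add_apply, Matrix.sub_apply, Matrix.smul_apply, Gamma_apply, mul_apply,
      Fin.sum_univ_three, Fin.sum_univ_two]
    fin_cases i <;> fin_cases j <;> simp [J8, K0, J3, U1, U5, emb1, emb3]
  · rw [v2]
    ext i j
    simp only [hNdef, submatrix_apply, Matrix.add_apply, Matrix.sub_apply, Matrix.smul_apply, Gamma_apply, mul_apply,
      Fin.sum_univ_three, Fin.sum_univ_two]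
    fin_cases i <;> fin_cases j <;> simp [J8, K0, U2, U4, emb2, emb3]
  · rw [v3]
    ext i j
    simp only [hNdef, submatrix_apply, Matrix.add_apply, Matrix.sub_apply, Matrix.smul_apply, Gamma_apply, mul_apply,
      Fin.sum_univ_three, Fin.sum_univ_two]
    fin_cases i <;> fin_cases j <;> simp [J8, K0, U3, U4, U5, sigma1, emb1, emb2, emb3] <;> ring

end
end

section
/- Let γ > 0, z ∈ ℂ with z ≠ 0, and let m ∈ Matrix (Fin 2) (Fin 2) ℂ have entries m₁₁, m₁₂, m₂₁, m₂₂. Let A₁ := !![m₂₂ + z, m₂₂, m₂₁; m₂₂, m₂₂, m₂₁ − i/γ; m₁₂, m₁₂ + i/γ, m₁₁] ∈ M₃(ℂ). Then (a) det A₁ = z · det T₁(m); and (b) if in addition m₂₂ = 4γ²z·m₁₁ and det T₁(m) ≠ 0, then A₁ is invertible and the (1,1) entry of −A₁⁻¹ equals −1/z − 4m₁₁/(z · det T₁(m)). -/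
open Matrix

noncomputable section

/-- `T₁(m) = m + !![−1/(γ²z), i/γ; −i/γ, 0]`. -/
def T1 (γ : ℝ) (z : ℂ) (m : Matrix (Fin 2) (Fin 2) ℂ) : Matrix (Fin 2) (Fin 2) ℂ :=
  m + !![-(1 / ((γ : ℂ) ^ 2 * z)), Complex.I / (γ : ℂ); -(Complex.I / (γ : ℂ)), 0]

/-- **Determinant identity and `(1,1)` entry of the first block (eqs. (150) and (79)).**
With `A₁ = z•J₃ − U₁ + U₅ᵀ m U₅` one has `det A₁ = z · det T₁(m)`, and if moreover
`m₂₂ = 4γ²z·m₁₁` and `det T₁(m) ≠ 0` then `A₁` is invertible and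
`(−A₁⁻¹)₁₁ = −1/z − 4m₁₁/(z·det T₁(m))`. -/
theorem first_block_det_and_entry
    (γ : ℝ) (hγ : 0 < γ) (z : ℂ) (hz : z ≠ 0)
    (m : Matrix (Fin 2) (Fin 2) ℂ)
    (A₁ : Matrix (Fin 3) (Fin 3) ℂ)
    (hA₁ : A₁ = !![m 1 1 + z, m 1 1, m 1 0;
                   m 1 1, m 1 1, m 1 0 - Complex.I / (γ : ℂ);
                   m 0 1, m 0 1 + Complex.I / (γ : ℂ), m 0 0]) :
    A₁.det = z * (T1 γ z m).det ∧
    (m 1 1 = 4 * (γ : ℂ) ^ 2 * z * m 0 0 → (T1 γ z m).det ≠ 0 →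
      IsUnit A₁.det ∧
      (-A₁⁻¹) 0 0 = -(1 / z) - 4 * m 0 0 / (z * (T1 γ z m).det)) := by
  have hg : (γ : ℂ) ≠ 0 := by exact_mod_cast hγ.ne'
  set w : ℂ := Complex.I / (γ : ℂ) with hw
  have hw2 : w ^ 2 = -(1 / (γ : ℂ) ^ 2) := by
    rw [hw, div_pow, Complex.I_sq]; ring
  have hT : (T1 γ z m).det = (m 0 0 - 1 / ((γ : ℂ) ^ 2 * z)) * m 1 1
      - (m 0 1 + w) * (m 1 0 - w) := by
    rw [Matrix.det_fin_two]
    simp [T1, ← hw]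
    ring
  have hdet : A₁.det = z * (T1 γ z m).det := by
    have h1 : A₁.det = z * (m 1 1 * m 0 0 - (m 1 0 - w) * (m 0 1 + w)) + w ^ 2 * m 1 1 := by
      rw [hA₁, Matrix.det_fin_three]
      simp
      ring
    rw [h1, hT, hw2]
    field_simp
    ring
  refine ⟨hdet, fun hm hD => ?_⟩
  have hne : A₁.det ≠ 0 := by rw [hdet]; exact mul_ne_zero hz hD
  refine ⟨isUnit_iff_ne_zero.mpr hne, ?_⟩
  have hadj : A₁.adjugate 0 0 = (T1 γ z m).det + 4 * m 0 0 := by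
    have h2 : A₁.adjugate 0 0 = m 1 1 * m 0 0 - (m 1 0 - w) * (m 0 1 + w) := by
      rw [hA₁, Matrix.adjugate_fin_three]
      simp
    rw [h2, hT, hm]
    field_simp
    ring
  rw [Matrix.neg_apply, Matrix.inv_def, Matrix.smul_apply, hadj, hdet, Ring.inverse_eq_inv',
    smul_eq_mul]
  field_simp
  ring

end
end

section
/- Let γ > 0, z ∈ ℂ with z ≠ 0, E ∈ ℂ, and let m ∈ Matrix (Fin 2) (Fin 2) ℂ be invertible such that T₁(m) and T₂(m) are invertible and m satisfies the Dyson equation m⁻¹ − E•σ₁ − T₁(m)⁻¹ − T₂(m)⁻¹ + σ₁ ⬝ m ⬝ σ₁ = 0, together with the symmetry m₂₂ = 4γ²z·m₁₁. Then m₂₁ − m₁₂ = (i/γ)·m₂₂. -/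
open Matrix

noncomputable section

/-- `T₂(m) = m + !![0, i/γ; −i/γ, −4]`. -/
def T2 (γ : ℝ) (m : Matrix (Fin 2) (Fin 2) ℂ) : Matrix (Fin 2) (Fin 2) ℂ :=
  m + !![0, Complex.I / (γ : ℂ); -(Complex.I / (γ : ℂ)), -4]

/-- **Off-diagonal identity (Lemma 2.6).**
An invertible solution `m` of the `2 × 2` block of the Dyson equation satisfying the symmetry
`m₂₂ = 4γ²z·m₁₁` also satisfies `m₂₁ − m₁₂ = (i/γ)·m₂₂`. -/
theorem offdiagonal_identity
    (γ : ℝ) (hγ : 0 < γ) (z : ℂ) (hz : z ≠ 0) (E : ℂ)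
    (m : Matrix (Fin 2) (Fin 2) ℂ)
    (hm : IsUnit m.det)
    (hT1 : IsUnit (T1 γ z m).det) (hT2 : IsUnit (T2 γ m).det)
    (hDEL : m⁻¹ - E • sigma1 - (T1 γ z m)⁻¹ - (T2 γ m)⁻¹ + sigma1 * m * sigma1 = 0)
    (hsym : m 1 1 = 4 * (γ : ℂ) ^ 2 * z * m 0 0) :
    m 1 0 - m 0 1 = (Complex.I / (γ : ℂ)) * m 1 1 := by
  have hg : (γ : ℂ) ≠ 0 := by exact_mod_cast hγ.ne'
  have hdet : (T1 γ z m).det = (T2 γ m).det := by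
    simp only [T1, T2, Matrix.det_fin_two, Matrix.add_apply, Matrix.of_apply, Matrix.cons_val',
      Matrix.cons_val_zero, Matrix.cons_val_one, Matrix.cons_val_fin_one, hsym]
    field_simp
    ring
  have h00 := congrFun (congrFun hDEL 0) 0
  have h01 := congrFun (congrFun hDEL 0) 1
  have h10 := congrFun (congrFun hDEL 1) 0
  have hD := hT2.ne_zero
  rw [Matrix.inv_def, Matrix.inv_def, Matrix.inv_def, hdet] at h00 h01 h10
  generalize (T2 γ m).det = D at h00 h01 h10 hD
  generalize m.det = Δ at h00 h01 h10
  generalize hs : Complex.I / (γ : ℂ) = s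
  simp [T1, T2, sigma1, Matrix.adjugate_fin_two, Matrix.vecMul, dotProduct, Matrix.mul_apply, Fin.sum_univ_two,
    Ring.inverse_eq_inv', hs] at h00 h01 h10
  have hDD : D⁻¹ ≠ 0 := inv_ne_zero hD
  generalize D⁻¹ = v at *
  generalize Δ⁻¹ = u at *
  apply mul_left_cancel₀ hDD
  linear_combination (1/4 : ℂ) * ((m 1 0 - m 0 1) * h00 + m 1 1 * (h10 - h01))

end
end

section
/- Let γ > 0, z ∈ ℂ with z ≠ 0, E ∈ ℂ, and let m ∈ Matrix (Fin 2) (Fin 2) ℂ be invertible such that T₁(m) and T₂(m) are invertible and m satisfies m⁻¹ − E•σ₁ − T₁(m)⁻¹ − T₂(m)⁻¹ + σ₁ ⬝ m ⬝ σ₁ = 0 together with the symmetries m₂₂ = 4γ²z·m₁₁ and m₂₁ − m₁₂ = (i/γ)·m₂₂. Then m₁₁ ≠ 0 and det m satisfies the quadratic equation (det m)² + (det m)·(4(z−1)m₁₁ + 1/(γ²z·m₁₁) − (1 + 1/γ²)) + (4(z−1)m₁₁ − 1/γ²) = 0. -/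
open Matrix

noncomputable section

/-- **Quadratic equation for `det m` (equation (85)).**
An invertible solution `m` of the `2 × 2` block of the Dyson equation satisfying the symmetries
`m₂₂ = 4γ²z·m₁₁` and `m₂₁ − m₁₂ = (i/γ)·m₂₂` has `m₁₁ ≠ 0` and `det m` solves
`(det m)² + (det m)·(4(z−1)m₁₁ + 1/(γ²z·m₁₁) − (1 + 1/γ²)) + (4(z−1)m₁₁ − 1/γ²) = 0`. -/
theorem det_m_quadratic
    (γ : ℝ) (hγ : 0 < γ) (z : ℂ) (hz : z ≠ 0) (E : ℂ)
    (m : Matrix (Fin 2) (Fin 2) ℂ)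
    (hm : IsUnit m.det)
    (hT1 : IsUnit (T1 γ z m).det) (hT2 : IsUnit (T2 γ m).det)
    (hDEL : m⁻¹ - E • sigma1 - (T1 γ z m)⁻¹ - (T2 γ m)⁻¹ + sigma1 * m * sigma1 = 0)
    (hsym1 : m 1 1 = 4 * (γ : ℂ) ^ 2 * z * m 0 0)
    (hsym2 : m 1 0 - m 0 1 = (Complex.I / (γ : ℂ)) * m 1 1) :
    m 0 0 ≠ 0 ∧
    (m.det) ^ 2
      + m.det * (4 * (z - 1) * m 0 0 + 1 / ((γ : ℂ) ^ 2 * z * m 0 0) - (1 + 1 / (γ : ℂ) ^ 2))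
      + (4 * (z - 1) * m 0 0 - 1 / (γ : ℂ) ^ 2) = 0 := by
  have hg : (γ : ℂ) ≠ 0 := by exact_mod_cast hγ.ne'
  have hI : Complex.I ^ 2 = -1 := Complex.I_sq
  have hD := hm.ne_zero
  have h1 := hT1.ne_zero
  have h2 := hT2.ne_zero
  have e1 : (T1 γ z m).det = m.det + 4 * (z - 1) * m 0 0 - 1 / (γ : ℂ) ^ 2 := by
    have hc : m 1 0 = m 0 1 + (Complex.I / (γ : ℂ)) * m 1 1 := by rw [← hsym2]; ring
    simp only [T1, det_fin_two, Matrix.add_apply, Matrix.of_apply, Matrix.cons_val', Matrix.cons_val_zero, Matrix.cons_val_one, Matrix.cons_val_fin_one]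
    rw [hc, hsym1]
    field_simp
    ring_nf
    simp only [hI]
    ring
  have e2 : (T2 γ m).det = m.det + 4 * (z - 1) * m 0 0 - 1 / (γ : ℂ) ^ 2 := by
    have hc : m 1 0 = m 0 1 + (Complex.I / (γ : ℂ)) * m 1 1 := by rw [← hsym2]; ring
    simp only [T2, det_fin_two, Matrix.add_apply, Matrix.of_apply, Matrix.cons_val', Matrix.cons_val_zero, Matrix.cons_val_one, Matrix.cons_val_fin_one]
    rw [hc, hsym1]
    field_simp
    ring_nf
    simp only [hI]
    ring
  have k := congrFun (congrFun hDEL 0) 0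
  have hs : (sigma1 * m * sigma1) 0 0 = m 1 1 := by
    simp [sigma1, Matrix.mul_apply, Fin.sum_univ_two, Matrix.vecMul, dotProduct]
  have hs' : (E • sigma1) 0 0 = 0 := by simp [sigma1]
  have i0 : (m⁻¹) 0 0 = (m.det)⁻¹ * m 1 1 := by
    rw [Matrix.inv_def, Ring.inverse_eq_inv', adjugate_fin_two]; simp
  have i1 : ((T1 γ z m)⁻¹) 0 0 = ((T1 γ z m).det)⁻¹ * m 1 1 := by
    rw [Matrix.inv_def, Ring.inverse_eq_inv', adjugate_fin_two]; simp [T1]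
  have i2 : ((T2 γ m)⁻¹) 0 0 = ((T2 γ m).det)⁻¹ * (m 1 1 - 4) := by
    rw [Matrix.inv_def, Ring.inverse_eq_inv', adjugate_fin_two]; simp [T2, sub_eq_add_neg]
  rw [Matrix.add_apply, Matrix.sub_apply, Matrix.sub_apply, Matrix.sub_apply, hs, hs', i0, i1, i2,
    e1, e2, hsym1, Matrix.zero_apply] at k
  rw [e1] at h1
  generalize m.det = D at *
  generalize m 0 0 = a at *
  obtain ⟨Δ, hΔ⟩ : ∃ Δ, Δ = D + 4 * (z - 1) * a - 1 / (γ : ℂ) ^ 2 := ⟨_, rfl⟩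
  rw [← hΔ] at k h1
  have ha : a ≠ 0 := by
    rintro rfl
    simp [h1] at k
  refine ⟨ha, ?_⟩
  have k2 : Δ * (1 + D) = 2 * D - D * (1 / ((γ : ℂ) ^ 2 * z * a)) := by
    field_simp at k ⊢
    linear_combination k / 4
  rw [hΔ] at k2
  linear_combination k2

end
end

section
/- Let E ∈ ℝ and γ > 0. Then there exists a unique ζ ∈ ℝ with (1 + E²)·ζ³ = −1/(16γ⁴), this ζ is negative, and the quadruple ξ₁₁ = ξ₂₂ = ζ, ξ₁₂ = ξ₂₁ = −E·ζ² solves the limiting system at z = 0: 1/(16γ⁴) + ξ₁₁²ξ₂₂ − E·ξ₁₁ξ₁₂ = 0, ξ₁₂ + E·ξ₁₁ξ₂₂ = 0, ξ₂₁ + E·ξ₁₁ξ₂₂ = 0, and −1/(16γ⁴) − ξ₁₁ξ₂₂² + E·ξ₂₁ξ₂₂ = 0. -/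
/-- **Leading-order solution at `z = 0` for `φ = 1` (equation (107)).**
There is a unique real `ζ` with `(1 + E²)·ζ³ = −1/(16γ⁴)`; it is negative, and the quadruple
`ξ₁₁ = ξ₂₂ = ζ`, `ξ₁₂ = ξ₂₁ = −E·ζ²` solves the limiting system `Q = 0` at `z = 0`. -/
theorem leading_order_solution_z_zero (E γ : ℝ) (hγ : 0 < γ) :
    ∃ ζ : ℝ,
      (1 + E ^ 2) * ζ ^ 3 = -(1 / (16 * γ ^ 4)) ∧
      (∀ ζ' : ℝ, (1 + E ^ 2) * ζ' ^ 3 = -(1 / (16 * γ ^ 4)) → ζ' = ζ) ∧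
      ζ < 0 ∧
      1 / (16 * γ ^ 4) + ζ ^ 2 * ζ - E * ζ * (-E * ζ ^ 2) = 0 ∧
      (-E * ζ ^ 2) + E * ζ * ζ = 0 ∧
      (-E * ζ ^ 2) + E * ζ * ζ = 0 ∧
      -(1 / (16 * γ ^ 4)) - ζ * ζ ^ 2 + E * (-E * ζ ^ 2) * ζ = 0 := by
  have hc : 0 < 1 / (16 * γ ^ 4) := by positivity
  generalize 1 / (16 * γ ^ 4) = c at hc ⊢
  have hE : 0 < 1 + E ^ 2 := by positivity
  have hd : 0 < c / (1 + E ^ 2) := div_pos hc hE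
  obtain ⟨r, hr, hr3⟩ : ∃ r : ℝ, 0 < r ∧ r ^ 3 = c / (1 + E ^ 2) := by
    refine ⟨(c / (1 + E ^ 2)) ^ ((1 : ℝ) / 3), Real.rpow_pos_of_pos hd _, ?_⟩
    rw [← Real.rpow_natCast, ← Real.rpow_mul hd.le]
    norm_num
  have h : (1 + E ^ 2) * (-r) ^ 3 = -c := by
    have h1 : (1 + E ^ 2) * r ^ 3 = c := by
      rw [hr3]
      field_simp
    linear_combination -h1
  refine ⟨-r, h, ?_, by linarith, ?_, by ring, by ring, ?_⟩
  · intro y hy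
    have h2 : y ^ 3 = (-r) ^ 3 := mul_left_cancel₀ hE.ne' (hy.trans h.symm)
    exact (Odd.strictMono_pow (by decide : Odd 3)).injective h2
  · linear_combination h
  · linear_combination -h
end

section
/- Let γ > 0. Then 2·√(1 + 6γ² + γ⁴) − 2 − 2γ² > 0. Moreover, for every E ∈ ℝ with |E| < (1/γ)·√(2√(1+6γ²+γ⁴) − 2 − 2γ²), set ξ₀ := −√(2√(1+6γ²+γ⁴) − 2 − 2γ² − γ²E²) and ν₀ := 16γ³E / (ξ₀·(4 + γ²E² + ξ₀²)). Then: (i) ξ₀³ν₀ + (4 + γ²E²)·ξ₀ν₀ − 16γ³E = 0; (ii) ξ₀⁴ + (2E²γ² + 4 + 4γ²)·ξ₀² + γ²(γ²E⁴ + 4E²(1+γ²) − 16) − 16iγ³E + iE²γ²·ξ₀ν₀ + 4i·ξ₀ν₀ + i·ξ₀³ν₀ = 0; and (iii) ξ₀ is the unique negative real number ξ satisfying γ²E⁴ + ξ⁴/γ² + (4/γ²)(1+γ²)ξ² + 4E²(1 + γ² + ξ²/2) − 16 = 0. -/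
/-- **Leading-order solution at `z = 1` for `φ = 1` (equations (109), (110), (170)).**
One has `2√(1+6γ²+γ⁴) − 2 − 2γ² > 0`, and for every admissible energy `E`, the pair
`(ξ₀, ν₀)` solves the leading-order system `(q₂, q₁) = 0` and `ξ₀` is the unique negative
root of the sextic `r = 0`. -/
theorem leading_order_solution_z_one (γ : ℝ) (hγ : 0 < γ) :
    0 < 2 * Real.sqrt (1 + 6 * γ ^ 2 + γ ^ 4) - 2 - 2 * γ ^ 2 ∧
    ∀ E : ℝ,
      |E| < (1 / γ) * Real.sqrt (2 * Real.sqrt (1 + 6 * γ ^ 2 + γ ^ 4) - 2 - 2 * γ ^ 2) →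
      ∀ ξ₀ ν₀ : ℝ,
        ξ₀ = -Real.sqrt (2 * Real.sqrt (1 + 6 * γ ^ 2 + γ ^ 4) - 2 - 2 * γ ^ 2
            - γ ^ 2 * E ^ 2) →
        ν₀ = 16 * γ ^ 3 * E / (ξ₀ * (4 + γ ^ 2 * E ^ 2 + ξ₀ ^ 2)) →
        -- (i) q₂ = 0
        (ξ₀ ^ 3 * ν₀ + (4 + γ ^ 2 * E ^ 2) * ξ₀ * ν₀ - 16 * γ ^ 3 * E = 0) ∧
        -- (ii) q₁ = 0 (an equation in ℂ)
        ((ξ₀ : ℂ) ^ 4 + (2 * (E : ℂ) ^ 2 * (γ : ℂ) ^ 2 + 4 + 4 * (γ : ℂ) ^ 2) * (ξ₀ : ℂ) ^ 2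
            + (γ : ℂ) ^ 2 * ((γ : ℂ) ^ 2 * (E : ℂ) ^ 4
              + 4 * (E : ℂ) ^ 2 * (1 + (γ : ℂ) ^ 2) - 16)
            - 16 * Complex.I * (γ : ℂ) ^ 3 * (E : ℂ)
            + Complex.I * (E : ℂ) ^ 2 * (γ : ℂ) ^ 2 * (ξ₀ : ℂ) * (ν₀ : ℂ)
            + 4 * Complex.I * (ξ₀ : ℂ) * (ν₀ : ℂ)
            + Complex.I * (ξ₀ : ℂ) ^ 3 * (ν₀ : ℂ) = 0) ∧
        -- (iii) ξ₀ is the unique negative root of r = 0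
        (ξ₀ < 0 ∧
          γ ^ 2 * E ^ 4 + ξ₀ ^ 4 / γ ^ 2 + (4 / γ ^ 2) * (1 + γ ^ 2) * ξ₀ ^ 2
            + 4 * E ^ 2 * (1 + γ ^ 2 + ξ₀ ^ 2 / 2) - 16 = 0 ∧
          ∀ ξ : ℝ, ξ < 0 →
            γ ^ 2 * E ^ 4 + ξ ^ 4 / γ ^ 2 + (4 / γ ^ 2) * (1 + γ ^ 2) * ξ ^ 2
              + 4 * E ^ 2 * (1 + γ ^ 2 + ξ ^ 2 / 2) - 16 = 0 → ξ = ξ₀) := by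
  set S := Real.sqrt (1 + 6 * γ ^ 2 + γ ^ 4) with hS
  have hS2 : S ^ 2 = 1 + 6 * γ ^ 2 + γ ^ 4 := Real.sq_sqrt (by positivity)
  have hS0 : 0 ≤ S := Real.sqrt_nonneg _
  have hγ2 : 0 < γ ^ 2 := by positivity
  have hpos : 0 < 2 * S - 2 - 2 * γ ^ 2 := by
    have : 1 + γ ^ 2 < S := by
      apply lt_of_pow_lt_pow_left₀ 2 hS0
      rw [hS2]
      nlinarith
    linarith
  refine ⟨hpos, ?_⟩
  intro E hE ξ₀ ν₀ hξ hν
  have hE1 : γ * |E| < Real.sqrt (2 * S - 2 - 2 * γ ^ 2) := by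
    have h := mul_lt_mul_of_pos_left hE hγ
    have h2 : γ * (1 / γ * Real.sqrt (2 * S - 2 - 2 * γ ^ 2))
        = Real.sqrt (2 * S - 2 - 2 * γ ^ 2) := by
      field_simp
    rwa [h2] at h
  have hE2 : γ ^ 2 * E ^ 2 < 2 * S - 2 - 2 * γ ^ 2 := by
    have h := (Real.lt_sqrt (by positivity)).1 hE1
    rwa [mul_pow, sq_abs] at h
  have hξneg : ξ₀ < 0 := by
    rw [hξ]
    exact neg_lt_zero.2 (Real.sqrt_pos.2 (by linarith))
  have hξ2 : ξ₀ ^ 2 = 2 * S - 2 - 2 * γ ^ 2 - γ ^ 2 * E ^ 2 := by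
    rw [hξ, neg_sq]
    exact Real.sq_sqrt (by linarith)
  have hq2 : ξ₀ ^ 3 * ν₀ + (4 + γ ^ 2 * E ^ 2) * ξ₀ * ν₀ - 16 * γ ^ 3 * E = 0 := by
    have hd : ξ₀ * (4 + γ ^ 2 * E ^ 2 + ξ₀ ^ 2) ≠ 0 :=
      mul_ne_zero hξneg.ne (by positivity)
    have h := (eq_div_iff hd).1 hν
    linear_combination h
  have hs : (ξ₀ ^ 2 + γ ^ 2 * E ^ 2) ^ 2 + 4 * (1 + γ ^ 2) * (ξ₀ ^ 2 + γ ^ 2 * E ^ 2)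
      - 16 * γ ^ 2 = 0 := by
    rw [hξ2]
    linear_combination 4 * hS2
  have key : ∀ ξ : ℝ, γ ^ 2 * E ^ 4 + ξ ^ 4 / γ ^ 2 + (4 / γ ^ 2) * (1 + γ ^ 2) * ξ ^ 2
      + 4 * E ^ 2 * (1 + γ ^ 2 + ξ ^ 2 / 2) - 16
      = ((ξ ^ 2 + γ ^ 2 * E ^ 2) ^ 2 + 4 * (1 + γ ^ 2) * (ξ ^ 2 + γ ^ 2 * E ^ 2)
      - 16 * γ ^ 2) / γ ^ 2 := by
    intro ξ
    field_simp
    ring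
  refine ⟨hq2, ?_, hξneg, ?_, ?_⟩
  · have h1 := congrArg (fun x : ℝ => (x : ℂ)) hq2
    have h2 := congrArg (fun x : ℝ => (x : ℂ)) hs
    push_cast at h1 h2
    linear_combination h2 + Complex.I * h1
  · rw [key, hs, zero_div]
  · intro ξ hξn h
    rw [key, div_eq_zero_iff] at h
    have h := h.resolve_right hγ2.ne'
    have hm : (ξ - ξ₀) * ((ξ + ξ₀) * (ξ ^ 2 + ξ₀ ^ 2 + 2 * (γ ^ 2 * E ^ 2)
        + 4 * (1 + γ ^ 2))) = 0 := by
      linear_combination h - hs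
    have hne : (ξ + ξ₀) * (ξ ^ 2 + ξ₀ ^ 2 + 2 * (γ ^ 2 * E ^ 2) + 4 * (1 + γ ^ 2)) ≠ 0 :=
      mul_ne_zero (by linarith) (by positivity)
    exact sub_eq_zero.1 ((mul_eq_zero.1 hm).resolve_right hne)
end

section
/- Let φ ∈ (0, 1) and E ∈ ℝ. Then there exists a unique real ξ > 0 such that ξ⁶ + (E² + 8φ − 4)·ξ⁴ + 4φ(E² + 5φ − 4)·ξ² + 16(φ − 1)φ² = 0. -/
theorem cubic_aux (a b c x y : ℝ) (hc : 0 < c) (hab : 0 ≤ a ∨ b ≤ 0) (hx : 0 < x) (hxy : x < y)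
    (h1 : x ^ 3 + a * x ^ 2 + b * x - c = 0) (h2 : y ^ 3 + a * y ^ 2 + b * y - c = 0) : False := by
  have hy : 0 < y := hx.trans hxy
  have hd : 0 < y - x := sub_pos.2 hxy
  rcases hab with ha | hb
  · have e : (y - x) * (x * y * (x + y) + a * (x * y) + c) = 0 := by
      linear_combination x * h2 - y * h1
    have : 0 < (y - x) * (x * y * (x + y) + a * (x * y) + c) := by positivity
    linarith
  · have hb' : 0 ≤ -b := by linarith
    have e : (y - x) * (x ^ 2 * y ^ 2 + (-b) * (x * y) + c * (x + y)) = 0 := by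
      linear_combination x ^ 2 * h2 - y ^ 2 * h1
    have : 0 < (y - x) * (x ^ 2 * y ^ 2 + (-b) * (x * y) + c * (x + y)) := by positivity
    linarith

/-- **Unique positive root of the sextic at `z = 0` for `φ ∈ (0,1)` (equation (42)).**
For `φ ∈ (0, 1)` and `E ∈ ℝ` there is a unique positive real `ξ` with
`ξ⁶ + (E² + 8φ − 4)ξ⁴ + 4φ(E² + 5φ − 4)ξ² + 16(φ − 1)φ² = 0`. -/
theorem unique_positive_root_sextic (φ E : ℝ) (hφ : φ ∈ Set.Ioo (0 : ℝ) 1) :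
    ∃! ξ : ℝ, 0 < ξ ∧
      ξ ^ 6 + (E ^ 2 + 8 * φ - 4) * ξ ^ 4 + 4 * φ * (E ^ 2 + 5 * φ - 4) * ξ ^ 2
        + 16 * (φ - 1) * φ ^ 2 = 0 := by
  obtain ⟨h0, h1⟩ := hφ
  have hc : 0 < 16 * (1 - φ) * φ ^ 2 := by
    have : 0 < 1 - φ := by linarith
    positivity
  have hab : 0 ≤ E ^ 2 + 8 * φ - 4 ∨ 4 * φ * (E ^ 2 + 5 * φ - 4) ≤ 0 := by
    by_cases h : 0 ≤ E ^ 2 + 8 * φ - 4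
    · exact Or.inl h
    · right
      apply mul_nonpos_of_nonneg_of_nonpos <;> linarith
  have huniq : ∀ x y : ℝ, 0 < x → x < y →
      x ^ 6 + (E ^ 2 + 8 * φ - 4) * x ^ 4 + 4 * φ * (E ^ 2 + 5 * φ - 4) * x ^ 2
        + 16 * (φ - 1) * φ ^ 2 = 0 →
      y ^ 6 + (E ^ 2 + 8 * φ - 4) * y ^ 4 + 4 * φ * (E ^ 2 + 5 * φ - 4) * y ^ 2
        + 16 * (φ - 1) * φ ^ 2 = 0 → False := by
    intro x y hx hxy e1 e2
    refine cubic_aux _ _ _ (x ^ 2) (y ^ 2) hc hab (by positivity) (by gcongr) ?_ ?_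
    · linear_combination e1
    · linear_combination e2
  have hex : ∃ ξ ∈ Set.Icc (0 : ℝ) 2,
      ξ ^ 6 + (E ^ 2 + 8 * φ - 4) * ξ ^ 4 + 4 * φ * (E ^ 2 + 5 * φ - 4) * ξ ^ 2
        + 16 * (φ - 1) * φ ^ 2 = 0 := by
    have hcont : ContinuousOn (fun ξ : ℝ => ξ ^ 6 + (E ^ 2 + 8 * φ - 4) * ξ ^ 4
        + 4 * φ * (E ^ 2 + 5 * φ - 4) * ξ ^ 2 + 16 * (φ - 1) * φ ^ 2) (Set.Icc 0 2) := by
      fun_prop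
    refine intermediate_value_Icc (by norm_num) hcont ⟨?_, ?_⟩
    · skip
      linarith
    · skip
      have : 0 ≤ 16 * E ^ 2 + 64 * φ + 16 * φ * E ^ 2 + 64 * φ ^ 2 + 16 * φ ^ 3 := by positivity
      linarith
  obtain ⟨ξ, ⟨hξ0, -⟩, hξ⟩ := hex
  have hpos : 0 < ξ := by
    rcases hξ0.lt_or_eq with h | h
    · exact h
    · subst h
      exfalso
      linarith
  refine ⟨ξ, ⟨hpos, hξ⟩, ?_⟩
  rintro y ⟨hy, ey⟩
  rcases lt_trichotomy y ξ with h | h | h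
  · exact (huniq _ _ hy h ey hξ).elim
  · exact h
  · exact (huniq _ _ hpos h hξ ey).elim
end

section
/- Let φ ∈ (0, 1), E ∈ ℝ, and let ξ₀ > 0 be a real number satisfying ξ₀⁶ + (E² + 8φ − 4)·ξ₀⁴ + 4φ(E² + 5φ − 4)·ξ₀² + 16(φ − 1)φ² = 0, and set ν₀ := E·ξ₀² / (ξ₀² + 2φ). Then: (i) ξ₀² − ν₀² + 2E·ν₀ + 4(φ − 1) = 0; (ii) the Jacobian J(ξ₀, ν₀) := 3ξ₀⁴ + ((3ν₀² − 6ν₀E + 4E²) + 10φ − 4)·ξ₀² + 2φ(4φ − 4 + 2E·ν₀ − ν₀²) satisfies J(ξ₀, ν₀) = 2ξ₀²·(3ξ₀² + 2E² + 10φ − 8); and (iii) J(ξ₀, ν₀) ≠ 0. -/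
/-- **Nonvanishing of the Jacobian at the leading-order solution (equation (147)).**
If `ξ₀ > 0` solves the sextic `r = 0` and `ν₀ = E·ξ₀²/(ξ₀² + 2φ)`, then
(i) `q₁/ξ₀ = 0`, (ii) the Jacobian simplifies to `2ξ₀²(3ξ₀² + 2E² + 10φ − 8)`, and
(iii) the Jacobian does not vanish. -/
theorem jacobian_nonvanishing (φ E : ℝ) (hφ : φ ∈ Set.Ioo (0 : ℝ) 1)
    (ξ₀ : ℝ) (hξ₀pos : 0 < ξ₀)
    (hroot : ξ₀ ^ 6 + (E ^ 2 + 8 * φ - 4) * ξ₀ ^ 4 + 4 * φ * (E ^ 2 + 5 * φ - 4) * ξ₀ ^ 2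
        + 16 * (φ - 1) * φ ^ 2 = 0)
    (ν₀ : ℝ) (hν₀ : ν₀ = E * ξ₀ ^ 2 / (ξ₀ ^ 2 + 2 * φ)) :
    (ξ₀ ^ 2 - ν₀ ^ 2 + 2 * E * ν₀ + 4 * (φ - 1) = 0) ∧
    (3 * ξ₀ ^ 4 + ((3 * ν₀ ^ 2 - 6 * ν₀ * E + 4 * E ^ 2) + 10 * φ - 4) * ξ₀ ^ 2
        + 2 * φ * (4 * φ - 4 + 2 * E * ν₀ - ν₀ ^ 2)
      = 2 * ξ₀ ^ 2 * (3 * ξ₀ ^ 2 + 2 * E ^ 2 + 10 * φ - 8)) ∧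
    (3 * ξ₀ ^ 4 + ((3 * ν₀ ^ 2 - 6 * ν₀ * E + 4 * E ^ 2) + 10 * φ - 4) * ξ₀ ^ 2
        + 2 * φ * (4 * φ - 4 + 2 * E * ν₀ - ν₀ ^ 2) ≠ 0) := by
  obtain ⟨h0, h1⟩ := hφ
  have hx : 0 < ξ₀ ^ 2 := by positivity
  have hs : ξ₀ ^ 2 + 2 * φ ≠ 0 := by positivity
  have hi : ξ₀ ^ 2 - ν₀ ^ 2 + 2 * E * ν₀ + 4 * (φ - 1) = 0 := by
    have hν : ν₀ * (ξ₀ ^ 2 + 2 * φ) = E * ξ₀ ^ 2 := by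
      rw [hν₀]; field_simp
    have h2 : (ξ₀ ^ 2 + 2 * φ) ^ 2 * (ξ₀ ^ 2 - ν₀ ^ 2 + 2 * E * ν₀ + 4 * (φ - 1)) = 0 := by
      linear_combination hroot + (2 * E * (ξ₀ ^ 2 + 2 * φ) - ν₀ * (ξ₀ ^ 2 + 2 * φ) - E * ξ₀ ^ 2) * hν
    exact (mul_eq_zero.mp h2).resolve_left (pow_ne_zero 2 hs)
  have hii : 3 * ξ₀ ^ 4 + ((3 * ν₀ ^ 2 - 6 * ν₀ * E + 4 * E ^ 2) + 10 * φ - 4) * ξ₀ ^ 2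
        + 2 * φ * (4 * φ - 4 + 2 * E * ν₀ - ν₀ ^ 2)
      = 2 * ξ₀ ^ 2 * (3 * ξ₀ ^ 2 + 2 * E ^ 2 + 10 * φ - 8) := by
    linear_combination (2 * φ - 3 * ξ₀ ^ 2) * hi
  refine ⟨hi, hii, ?_⟩
  rw [hii]
  intro h
  have h3 : 3 * ξ₀ ^ 2 + 2 * E ^ 2 + 10 * φ - 8 = 0 :=
    (mul_eq_zero.mp h).resolve_left (by positivity)
  have h4 : ξ₀ ^ 6 + 6 * φ * ξ₀ ^ 4 + 32 * φ ^ 2 * (1 - φ) = 0 := by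
    linear_combination (ξ₀ ^ 4 + 4 * φ * ξ₀ ^ 2) * h3 - 2 * hroot
  have h5 : 0 < 1 - φ := by linarith
  have h6 : 0 < ξ₀ ^ 6 + 6 * φ * ξ₀ ^ 4 + 32 * φ ^ 2 * (1 - φ) := by positivity
  linarith
end

section
/- Let γ > 0, E ∈ ℂ, and let z ∈ ℂ with z ≠ 0 and z ≠ 1. Let ξ ∈ ℂ satisfy ξ² = (4 − E²)/(z(1 − z)), and define m := !![i·ξ/(4γ), E/2 + z·ξ/2; E/2 − z·ξ/2, i·z·γ·ξ] ∈ Matrix (Fin 2) (Fin 2) ℂ. Then det m = −1 (in particular m is invertible), and m solves the φ = 0 Dyson equation −m⁻¹ = −E•σ₁ + σ₁ ⬝ m ⬝ σ₁, where σ₁ := !![0,1; 1,0]. Moreover, if in addition γ > 0, E ∈ ℝ with |E| < 2, z = λ ∈ (0,1) is real and ξ := √((4−E²)/(λ(1−λ))) > 0, then the Hermitian matrix Im m := (m − mᴴ)/(2i) is positive semidefinite. -/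
open Matrix
open scoped ComplexOrder

noncomputable section

/-- **Explicit solution of the `φ = 0` Dyson equation (Lemma 3.7).**
With `ξ² = (4 − E²)/(z(1 − z))`, the matrix
`m = !![iξ/(4γ), E/2 + zξ/2; E/2 − zξ/2, izγξ]` has `det m = −1` and solves
`−m⁻¹ = −E•σ₁ + σ₁ m σ₁`. Moreover, for real data `E = E'`, `z = λ ∈ (0,1)`,
`ξ = √((4−E'²)/(λ(1−λ)))` the imaginary part `(m − mᴴ)/(2i)` is positive semidefinite. -/
theorem phi_zero_dyson_solution
    (γ : ℝ) (hγ : 0 < γ) (E z ξ : ℂ) (hz0 : z ≠ 0) (hz1 : z ≠ 1)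
    (hξ : ξ ^ 2 = (4 - E ^ 2) / (z * (1 - z)))
    (m : Matrix (Fin 2) (Fin 2) ℂ)
    (hm : m = !![Complex.I * ξ / (4 * (γ : ℂ)), E / 2 + z * ξ / 2;
                 E / 2 - z * ξ / 2, Complex.I * z * (γ : ℂ) * ξ]) :
    m.det = -1 ∧
    -m⁻¹ = -(E • sigma1) + sigma1 * m * sigma1 ∧
    (∀ (E' lam : ℝ), |E'| < 2 → lam ∈ Set.Ioo (0 : ℝ) 1 →
      E = (E' : ℂ) → z = (lam : ℂ) →
      ξ = (Real.sqrt ((4 - E' ^ 2) / (lam * (1 - lam))) : ℂ) →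
      (((2 * Complex.I)⁻¹ : ℂ) • (m - mᴴ)).PosSemidef) := by
  have hg : (γ : ℂ) ≠ 0 := by exact_mod_cast hγ.ne'
  have h1 : (1 - z) ≠ 0 := sub_ne_zero.mpr (Ne.symm hz1)
  have hx : ξ ^ 2 * (z * (1 - z)) = 4 - E ^ 2 := by
    rw [hξ]; exact div_mul_cancel₀ _ (mul_ne_zero hz0 h1)
  have hI : Complex.I ^ 2 = -1 := Complex.I_sq
  have hdet : m.det = -1 := by
    rw [hm, Matrix.det_fin_two_of]
    have h2 : Complex.I * ξ / (4 * (γ : ℂ)) * (Complex.I * z * (γ : ℂ) * ξ)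
        = Complex.I ^ 2 * z * ξ ^ 2 / 4 := by
      field_simp
    rw [h2, hI]
    linear_combination (-1 / 4) * hx
  refine ⟨hdet, ?_, ?_⟩
  · have hinv : m⁻¹ = -m.adjugate := by
      rw [Matrix.inv_def, hdet]
      simp [Ring.inverse_eq_inv']
    rw [hinv, neg_neg, hm, Matrix.adjugate_fin_two_of]
    ext i j
    fin_cases i <;> fin_cases j <;>
      simp [sigma1, Matrix.mul_apply, Fin.sum_univ_two] <;> ring
  · rintro E' lam hE ⟨hl0, hl1⟩ rfl rfl hxi
    set x := Real.sqrt ((4 - E' ^ 2) / (lam * (1 - lam))) with hxdef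
    have hx0 : 0 ≤ x := Real.sqrt_nonneg _
    have hr : (0 : ℝ) ≤ x / (4 * γ) := by positivity
    have hs : (0 : ℝ) ≤ x * γ * lam * (1 - lam) :=
      mul_nonneg (by positivity) (by linarith)
    have hr' : (0 : ℂ) ≤ ((x / (4 * γ) : ℝ) : ℂ) := by exact_mod_cast hr
    have hs' : (0 : ℂ) ≤ ((x * γ * lam * (1 - lam) : ℝ) : ℂ) := by exact_mod_cast hs
    have key := ((Matrix.posSemidef_vecMulVec_self_star
        (![1, 2 * Complex.I * γ * lam] : Fin 2 → ℂ)).smul hr').add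
      ((Matrix.posSemidef_vecMulVec_self_star (![0, 1] : Fin 2 → ℂ)).smul hs')
    convert key using 1
    rw [hm, hxi]
    have hI0 := Complex.I_ne_zero
    ext i j
    simp only [Matrix.add_apply, Matrix.smul_apply, Matrix.sub_apply,
      Matrix.conjTranspose_apply, Matrix.vecMulVec_apply, Pi.star_apply, smul_eq_mul]
    fin_cases i <;> fin_cases j <;>
      simp [Matrix.vecMulVec_apply, -Complex.inv_I] <;> field_simp <;>
      ring_nf <;> simp [hI] <;> ring

end
end

section
/- Let γ > 0 and E ∈ ℝ with |E| < 2. Then the function λ ↦ ρ_{E,γ}(λ) is integrable on the interval (0, 1) and ∫₀¹ ρ_{E,γ}(λ) dλ = 1, i.e. ρ_{E,γ} is a probability density on (0, 1). -/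
open MeasureTheory

noncomputable section

/-- The limiting density of transmission eigenvalues in the regime `φ = N/M → 0`
(Theorem 1.2(iv)). -/
def rhoE (γ E lam : ℝ) : ℝ :=
  (1 / Real.pi) * (γ * (1 + γ ^ 2)
      / ((1 + γ ^ 2) ^ 2 * lam + γ ^ 2 * (4 - E ^ 2) * (1 - lam)))
    * Real.sqrt ((4 - E ^ 2) / (lam * (1 - lam)))

lemma rhoE_aux_deriv (A b x : ℝ) (hA : 0 < A) (hb : 0 < b) (hx0 : 0 < x) (hx1 : x < 1) :
    HasDerivAt (fun x : ℝ => (1 / Real.pi) *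
      Real.arccos ((b ^ 2 * (1 - x) - A ^ 2 * x) / (A ^ 2 * x + b ^ 2 * (1 - x))))
      ((1 / Real.pi) * (A * b / (A ^ 2 * x + b ^ 2 * (1 - x)) / Real.sqrt (x * (1 - x)))) x := by
  have h1 : 0 < 1 - x := by linarith
  have hD : 0 < A ^ 2 * x + b ^ 2 * (1 - x) := by positivity
  set u := (b ^ 2 * (1 - x) - A ^ 2 * x) / (A ^ 2 * x + b ^ 2 * (1 - x)) with hu
  have hsq : 1 - u ^ 2 = (2 * A * b / (A ^ 2 * x + b ^ 2 * (1 - x))) ^ 2 * (x * (1 - x)) := by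
    rw [hu]; field_simp; ring
  have hxx : 0 < x * (1 - x) := by positivity
  have hpos : 0 < 1 - u ^ 2 := by rw [hsq]; positivity
  have hsqrt : Real.sqrt (1 - u ^ 2) =
      2 * A * b / (A ^ 2 * x + b ^ 2 * (1 - x)) * Real.sqrt (x * (1 - x)) := by
    rw [hsq, Real.sqrt_mul (by positivity), Real.sqrt_sq (by positivity)]
  have hne1 : u ≠ -1 := by intro h; rw [h] at hpos; norm_num at hpos
  have hne2 : u ≠ 1 := by intro h; rw [h] at hpos; norm_num at hpos
  have hid := hasDerivAt_id x
  have hnum : HasDerivAt (fun x : ℝ => b ^ 2 * (1 - x) - A ^ 2 * x)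
      (b ^ 2 * (-1) - A ^ 2 * 1) x :=
    ((hid.const_sub 1).const_mul (b ^ 2)).sub (hid.const_mul (A ^ 2))
  have hden : HasDerivAt (fun x : ℝ => A ^ 2 * x + b ^ 2 * (1 - x))
      (A ^ 2 * 1 + b ^ 2 * (-1)) x :=
    (hid.const_mul (A ^ 2)).add ((hid.const_sub 1).const_mul (b ^ 2))
  have hq := hnum.div hden hD.ne'
  have hf := ((Real.hasDerivAt_arccos hne1 hne2).comp x hq).const_mul (1 / Real.pi)
  refine hf.congr_deriv ?_
  rw [hsqrt]
  have hs : 0 < Real.sqrt (x * (1 - x)) := Real.sqrt_pos.mpr hxx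
  congr 1
  field_simp
  ring

/-- **`ρ_{E,γ}` is a probability density on `(0, 1)`.** -/
theorem rhoE_probability_density (γ E : ℝ) (hγ : 0 < γ) (hE : |E| < 2) :
    IntegrableOn (fun lam => rhoE γ E lam) (Set.Ioo (0 : ℝ) 1) volume ∧
    ∫ lam in Set.Ioo (0 : ℝ) 1, rhoE γ E lam = 1 := by
  have hE2 : 0 < 4 - E ^ 2 := by
    have := abs_lt.mp hE
    nlinarith
  set s := Real.sqrt (4 - E ^ 2) with hs
  have hs0 : 0 < s := Real.sqrt_pos.mpr hE2
  have hss : s ^ 2 = 4 - E ^ 2 := Real.sq_sqrt hE2.le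
  set A := 1 + γ ^ 2 with hA
  have hA0 : 0 < A := by positivity
  have hb0 : 0 < γ * s := by positivity
  set F : ℝ → ℝ := fun x : ℝ => (1 / Real.pi) *
      Real.arccos (((γ * s) ^ 2 * (1 - x) - A ^ 2 * x) / (A ^ 2 * x + (γ * s) ^ 2 * (1 - x)))
    with hF
  have hcont : ContinuousOn F (Set.Icc 0 1) := by
    refine continuousOn_const.mul (Real.continuous_arccos.comp_continuousOn ?_)
    refine ContinuousOn.div (by fun_prop) (by fun_prop) ?_
    intro x hx
    have h0 := hx.1
    have h1 : 0 ≤ 1 - x := by linarith [hx.2]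
    rcases h0.eq_or_lt with h | h
    · rw [← h]; simp [hγ.ne', hs0.ne']
    · positivity
  have hderiv : ∀ x ∈ Set.Ioo (0 : ℝ) 1, HasDerivAt F (rhoE γ E x) x := by
    intro x hx
    refine (rhoE_aux_deriv A (γ * s) x hA0 hb0 hx.1 hx.2).congr_deriv ?_
    rw [rhoE, Real.sqrt_div hE2.le, ← hs, mul_pow, hss, ← hA]
    ring
  have hnn : ∀ x ∈ Set.Ioo (0 : ℝ) 1, 0 ≤ rhoE γ E x := by
    intro x hx
    have h0 := hx.1
    have h1 : 0 < 1 - x := by linarith [hx.2]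
    rw [rhoE]; positivity
  have hint := intervalIntegral.integrableOn_deriv_of_nonneg hcont hderiv hnn
  refine ⟨hint.mono_set Set.Ioo_subset_Ioc_self, ?_⟩
  rw [← integral_Ioc_eq_integral_Ioo, ← intervalIntegral.integral_of_le zero_le_one,
    intervalIntegral.integral_eq_sub_of_hasDerivAt_of_le zero_le_one hcont hderiv
      ((intervalIntegrable_iff_integrableOn_Ioc_of_le zero_le_one).mpr hint)]
  have hF0 : F 0 = 0 := by
    simp [hF, div_self (pow_pos hb0 2).ne', hγ.ne', hs0.ne']
  have hF1 : F 1 = 1 := by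
    have : (-A ^ 2) / A ^ 2 = -1 := by field_simp
    simp [hF, this, Real.pi_ne_zero]
  rw [hF0, hF1, sub_zero]

end
end

section
/- Let γ > 0 and E ∈ ℝ with |E| < 2. Then 1 − (∫₀¹ λ²·ρ_{E,γ}(λ) dλ) / (∫₀¹ λ·ρ_{E,γ}(λ) dλ) = (1 + γ²) / (2·(1 + γ² + γ·√(4 − E²))), and in particular the first moment ∫₀¹ λ·ρ_{E,γ}(λ) dλ is nonzero. For γ = 1 and E = 0 this Fano factor equals 1/4. -/
open MeasureTheory

noncomputable section

def auxD (a b x : ℝ) : ℝ := a ^ 2 * x + b ^ 2 * (1 - x)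

def auxR (x : ℝ) : ℝ := Real.sqrt (x * (1 - x))

def auxK (a b x : ℝ) : ℝ := Real.arcsin ((a ^ 2 * x - b ^ 2 * (1 - x)) / auxD a b x)

def auxRho (a b x : ℝ) : ℝ := (1 / Real.pi) * (a * b / (auxD a b x * auxR x))

theorem auxD_pos {a b x : ℝ} (ha : 0 < a) (hb : 0 < b) (hx : x ∈ Set.Icc (0 : ℝ) 1) :
    0 < auxD a b x := by
  obtain ⟨h0, h1⟩ := hx
  unfold auxD
  rcases h0.eq_or_lt with h | h
  · rw [← h]; simp; positivity
  · have : 0 ≤ b ^ 2 * (1 - x) := mul_nonneg (by positivity) (by linarith)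
    positivity

theorem auxR_pos {x : ℝ} (hx : x ∈ Set.Ioo (0 : ℝ) 1) : 0 < auxR x :=
  Real.sqrt_pos.2 (mul_pos hx.1 (by linarith [hx.2]))

theorem auxR_sq {x : ℝ} (hx : x ∈ Set.Ioo (0 : ℝ) 1) : auxR x ^ 2 = x * (1 - x) :=
  Real.sq_sqrt (mul_pos hx.1 (by linarith [hx.2])).le

theorem auxR_cont (s : Set ℝ) : ContinuousOn auxR s := by
  unfold auxR; fun_prop

theorem auxK_cont {a b : ℝ} (ha : 0 < a) (hb : 0 < b) :
    ContinuousOn (auxK a b) (Set.Icc 0 1) := by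
  unfold auxK
  refine Real.continuous_arcsin.comp_continuousOn (ContinuousOn.div (by fun_prop) ?_ ?_)
  · unfold auxD; fun_prop
  · intro x hx; exact (auxD_pos ha hb hx).ne'

theorem auxK_zero {a b : ℝ} (hb : 0 < b) : auxK a b 0 = -(Real.pi / 2) := by
  have : (a ^ 2 * 0 - b ^ 2 * (1 - 0)) / auxD a b 0 = -1 := by
    unfold auxD; field_simp; ring
  rw [auxK, this, Real.arcsin_neg_one]

theorem auxK_one {a b : ℝ} (ha : 0 < a) : auxK a b 1 = Real.pi / 2 := by
  have : (a ^ 2 * 1 - b ^ 2 * (1 - 1)) / auxD a b 1 = 1 := by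
    unfold auxD; field_simp; ring
  rw [auxK, this, Real.arcsin_one]

theorem auxR_deriv {x : ℝ} (hx : x ∈ Set.Ioo (0 : ℝ) 1) :
    HasDerivAt auxR ((1 - 2 * x) / (2 * auxR x)) x := by
  have h : HasDerivAt (fun y : ℝ => y * (1 - y)) (1 - 2 * x) x := by
    refine ((hasDerivAt_id x).mul ((hasDerivAt_id x).const_sub 1)).congr_deriv ?_
    simp only [id]; ring
  exact h.sqrt (mul_pos hx.1 (by linarith [hx.2])).ne'

theorem auxK_deriv {a b x : ℝ} (ha : 0 < a) (hb : 0 < b) (hx : x ∈ Set.Ioo (0 : ℝ) 1) :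
    HasDerivAt (auxK a b) (a * b / (auxD a b x * auxR x)) x := by
  have hD := auxD_pos ha hb (Set.Ioo_subset_Icc_self hx)
  have hR := auxR_pos hx
  have hR2 := auxR_sq hx
  have hN : HasDerivAt (fun y : ℝ => a ^ 2 * y - b ^ 2 * (1 - y)) (a ^ 2 + b ^ 2) x := by
    refine (((hasDerivAt_id x).const_mul (a ^ 2)).sub
      (((hasDerivAt_id x).const_sub 1).const_mul (b ^ 2))).congr_deriv ?_
    ring
  have hDd : HasDerivAt (auxD a b) (a ^ 2 - b ^ 2) x := by
    refine (((hasDerivAt_id x).const_mul (a ^ 2)).add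
      (((hasDerivAt_id x).const_sub 1).const_mul (b ^ 2))).congr_deriv ?_
    ring
  have hq := hN.div hDd hD.ne'
  set X := (a ^ 2 * x - b ^ 2 * (1 - x)) / auxD a b x with hX
  have h1 : 1 - X ^ 2 = (2 * a * b * auxR x / auxD a b x) ^ 2 := by
    rw [hX]
    have : (2 * a * b * auxR x / auxD a b x) ^ 2
        = 4 * a ^ 2 * b ^ 2 * (x * (1 - x)) / auxD a b x ^ 2 := by
      rw [← hR2]; ring
    rw [this]
    field_simp
    unfold auxD
    ring
  have hp : 0 < 2 * a * b * auxR x / auxD a b x := by positivity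
  have h2 : 0 < 1 - X ^ 2 := by rw [h1]; positivity
  have hne1 : X ≠ -1 := by rintro h; rw [h] at h2; norm_num at h2
  have hne2 : X ≠ 1 := by rintro h; rw [h] at h2; norm_num at h2
  have hA := (Real.hasDerivAt_arcsin hne1 hne2).comp x hq
  rw [h1, Real.sqrt_sq hp.le] at hA
  refine HasDerivAt.congr_deriv (f := auxK a b) hA ?_
  field_simp
  unfold auxD
  ring

theorem auxFTC {F f : ℝ → ℝ} (hF : ContinuousOn F (Set.Icc 0 1))
    (hd : ∀ x ∈ Set.Ioo (0 : ℝ) 1, HasDerivAt F (f x) x)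
    (hn : ∀ x ∈ Set.Ioo (0 : ℝ) 1, 0 ≤ f x) :
    ∫ x in Set.Ioo (0 : ℝ) 1, f x = F 1 - F 0 := by
  rw [← integral_Ioc_eq_integral_Ioo, ← intervalIntegral.integral_of_le zero_le_one]
  refine intervalIntegral.integral_eq_sub_of_hasDerivAt_of_le zero_le_one hF hd ?_
  rw [intervalIntegrable_iff_integrableOn_Ioc_of_le zero_le_one]
  exact intervalIntegral.integrableOn_deriv_of_nonneg hF hd hn

theorem auxRho_nonneg {a b x : ℝ} (ha : 0 < a) (hb : 0 < b) (hx : x ∈ Set.Ioo (0 : ℝ) 1) :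
    0 ≤ auxRho a b x := by
  have hD := auxD_pos ha hb (Set.Ioo_subset_Icc_self hx)
  have hR := auxR_pos hx
  unfold auxRho
  positivity

theorem auxD_one (x : ℝ) : auxD 1 1 x = 1 := by unfold auxD; ring

theorem auxA_deriv {x : ℝ} (hx : x ∈ Set.Ioo (0 : ℝ) 1) :
    HasDerivAt (auxK 1 1) (1 / auxR x) x := by
  have := auxK_deriv one_pos one_pos hx
  simpa [auxD_one] using this

theorem auxR_zero : auxR 0 = 0 := by simp [auxR]
theorem auxR_one : auxR 1 = 0 := by simp [auxR]

theorem auxM {a b : ℝ} (ha : 0 < a) (hb : 0 < b) :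
    (∫ x in Set.Ioo (0 : ℝ) 1, x * auxRho a b x) = b / (a + b) ∧
    (∫ x in Set.Ioo (0 : ℝ) 1, x ^ 2 * auxRho a b x) = b * (a + 2 * b) / (2 * (a + b) ^ 2) := by
  have hpi := Real.pi_pos
  have cK := auxK_cont ha hb
  have cA := auxK_cont one_pos one_pos
  have cR := auxR_cont (Set.Icc 0 1)
  have n1 : ∀ x ∈ Set.Ioo (0 : ℝ) 1, 0 ≤ x * auxRho a b x :=
    fun x hx => mul_nonneg hx.1.le (auxRho_nonneg ha hb hx)
  have n2 : ∀ x ∈ Set.Ioo (0 : ℝ) 1, 0 ≤ x ^ 2 * auxRho a b x :=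
    fun x hx => mul_nonneg (by positivity) (auxRho_nonneg ha hb hx)
  by_cases hab : a = b
  · subst hab
    constructor
    · rw [auxFTC (F := fun x => (1 / Real.pi) * (-auxR x + (1 / 2) * auxK 1 1 x)) (by fun_prop)
        ?_ n1]
      · simp only [auxR_zero, auxR_one, auxK_zero one_pos, auxK_one one_pos]
        field_simp; ring
      · intro x hx
        have hR := auxR_pos hx
        refine (((auxR_deriv hx).neg.add ((auxA_deriv hx).const_mul (1 / 2))).const_mul
          (1 / Real.pi)).congr_deriv ?_
        have : auxD a a x = a ^ 2 := by unfold auxD; ring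
        rw [auxRho, this]
        field_simp; ring
    · rw [auxFTC (F := fun x => (1 / Real.pi) *
        (-(1 / 2) * (x * auxR x) + (3 / 4) * (-auxR x + (1 / 2) * auxK 1 1 x))) (by fun_prop)
        ?_ n2]
      · simp only [auxR_zero, auxR_one, auxK_zero one_pos, auxK_one one_pos]
        field_simp; ring
      · intro x hx
        have hR := auxR_pos hx
        have hR2 := auxR_sq hx
        refine (((((hasDerivAt_id x).mul (auxR_deriv hx)).const_mul (-(1 / 2))).add
          (((auxR_deriv hx).neg.add ((auxA_deriv hx).const_mul (1 / 2))).const_mul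
          (3 / 4))).const_mul (1 / Real.pi)).congr_deriv ?_
        have : auxD a a x = a ^ 2 := by unfold auxD; ring
        rw [auxRho, this]
        simp only [id]
        field_simp
        rw [hR2]; ring
  · have hne : a - b ≠ 0 := sub_ne_zero.2 hab
    have hs : a + b ≠ 0 := by positivity
    have d1 : ∀ x ∈ Set.Ioo (0 : ℝ) 1, HasDerivAt
        (fun x => (b / (Real.pi * ((a - b) * (a + b)))) * (a * auxK 1 1 x - b * auxK a b x))
        (x * auxRho a b x) x := by
      intro x hx
      have hR := auxR_pos hx
      have hD := auxD_pos ha hb (Set.Ioo_subset_Icc_self hx)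
      refine ((((auxA_deriv hx).const_mul a).sub ((auxK_deriv ha hb hx).const_mul b)).const_mul
        _).congr_deriv ?_
      rw [auxRho]
      field_simp
      unfold auxD; ring
    constructor
    · rw [auxFTC (by fun_prop) d1 n1]
      simp only [auxK_zero one_pos, auxK_one one_pos, auxK_zero hb, auxK_one ha]
      field_simp; ring
    · rw [auxFTC (F := fun x => (1 / ((a - b) * (a + b))) *
        ((a * b / Real.pi) * (-auxR x + (1 / 2) * auxK 1 1 x) - b ^ 2 *
        ((b / (Real.pi * ((a - b) * (a + b)))) * (a * auxK 1 1 x - b * auxK a b x))))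
        (by fun_prop) ?_ n2]
      · simp only [auxR_zero, auxR_one, auxK_zero one_pos, auxK_one one_pos, auxK_zero hb,
          auxK_one ha]
        field_simp; ring
      · intro x hx
        have hR := auxR_pos hx
        have hD := auxD_pos ha hb (Set.Ioo_subset_Icc_self hx)
        refine (((((auxR_deriv hx).neg.add ((auxA_deriv hx).const_mul (1 / 2))).const_mul
          (a * b / Real.pi)).sub ((d1 x hx).const_mul (b ^ 2))).const_mul _).congr_deriv ?_
        rw [auxRho]
        field_simp
        unfold auxD; ring

theorem rho_eq {γ E x : ℝ} (hγ : 0 < γ) (hE : |E| < 2) (hx : x ∈ Set.Ioo (0 : ℝ) 1) :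
    rhoE γ E x = auxRho (1 + γ ^ 2) (γ * Real.sqrt (4 - E ^ 2)) x := by
  have h4 : 0 < 4 - E ^ 2 := by
    have := abs_lt.1 hE
    nlinarith
  unfold rhoE auxRho auxD auxR
  rw [Real.sqrt_div h4.le, mul_pow, Real.sq_sqrt h4.le]
  rw [mul_assoc, div_mul_div_comm]
  ring_nf

theorem aux_main (γ E : ℝ) (hγ : 0 < γ) (hE : |E| < 2) :
    (1 - (∫ lam in Set.Ioo (0 : ℝ) 1, lam ^ 2 * rhoE γ E lam)
        / (∫ lam in Set.Ioo (0 : ℝ) 1, lam * rhoE γ E lam)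
      = (1 + γ ^ 2) / (2 * (1 + γ ^ 2 + γ * Real.sqrt (4 - E ^ 2)))) ∧
    (∫ lam in Set.Ioo (0 : ℝ) 1, lam * rhoE γ E lam) ≠ 0 := by
  have h4 : 0 < 4 - E ^ 2 := by
    have := abs_lt.1 hE
    nlinarith
  have ha : 0 < 1 + γ ^ 2 := by positivity
  have hb : 0 < γ * Real.sqrt (4 - E ^ 2) := mul_pos hγ (Real.sqrt_pos.2 h4)
  obtain ⟨m1, m2⟩ := auxM ha hb
  have e1 : (∫ lam in Set.Ioo (0 : ℝ) 1, lam * rhoE γ E lam) = _ :=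
    (setIntegral_congr_fun measurableSet_Ioo
      (fun x hx => congrArg (fun t => x * t) (rho_eq hγ hE hx))).trans m1
  have e2 : (∫ lam in Set.Ioo (0 : ℝ) 1, lam ^ 2 * rhoE γ E lam) = _ :=
    (setIntegral_congr_fun measurableSet_Ioo
      (fun x hx => congrArg (fun t => x ^ 2 * t) (rho_eq hγ hE hx))).trans m2
  rw [e1, e2]
  clear e1 e2 m1 m2
  generalize γ * Real.sqrt (4 - E ^ 2) = b at *
  generalize 1 + γ ^ 2 = a at *
  refine ⟨?_, by positivity⟩
  field_simp
  ring

/-- **The Fano factor for `φ = 0` (equation (236)).**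
`1 − (∫λ²ρ)/(∫λρ) = (1+γ²)/(2(1+γ²+γ√(4−E²)))`, the first moment is nonzero, and for
`γ = 1`, `E = 0` the Fano factor equals `1/4`. -/
theorem fano_factor_phi_zero (γ E : ℝ) (hγ : 0 < γ) (hE : |E| < 2) :
    (1 - (∫ lam in Set.Ioo (0 : ℝ) 1, lam ^ 2 * rhoE γ E lam)
        / (∫ lam in Set.Ioo (0 : ℝ) 1, lam * rhoE γ E lam)
      = (1 + γ ^ 2) / (2 * (1 + γ ^ 2 + γ * Real.sqrt (4 - E ^ 2)))) ∧
    (∫ lam in Set.Ioo (0 : ℝ) 1, lam * rhoE γ E lam) ≠ 0 ∧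
    (1 - (∫ lam in Set.Ioo (0 : ℝ) 1, lam ^ 2 * rhoE 1 0 lam)
        / (∫ lam in Set.Ioo (0 : ℝ) 1, lam * rhoE 1 0 lam) = 1 / 4) := by
  refine ⟨(aux_main γ E hγ hE).1, (aux_main γ E hγ hE).2, ?_⟩
  rw [(aux_main 1 0 one_pos (by norm_num)).1]
  have : Real.sqrt (4 - 0 ^ 2) = 2 := by
    rw [show (4 - 0 ^ 2 : ℝ) = 2 ^ 2 by norm_num]
    exact Real.sqrt_sq (by norm_num)
  rw [this]; norm_num

end
end
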